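/- arXiv:1808.09406 — 8 statements merged into one kernel-verified Lean document; each statement's English description precedes it below -/
import Mathlib

section
/- On a path of m items, for any number n of agents with identical monotonic valuations (all agents share one monotonic valuation u), there exists a connected EF1 allocation. -/
/-- A bundle of items on a path (modeled as `Fin m`) is connected iff it is an interval
(possibly empty). -/
def IsInterval {m : ℕ} (I : Finset (Fin m)) : Prop :=
  ∀ a b c : Fin m, a ≤ b → b ≤ c → a ∈ I → c ∈ I → b ∈ I

/-- A valuation is monotonic if larger bundles are weakly better. -/
def Monotonic {m : ℕ} (u : Finset (Fin m) → ℝ) : Prop :=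
  ∀ X Y : Finset (Fin m), X ⊆ Y → u X ≤ u Y

/-- A connected allocation on a path: every bundle is an interval, bundles are pairwise
disjoint, and every item belongs to some bundle. -/
def IsConnAlloc {n m : ℕ} (A : Fin n → Finset (Fin m)) : Prop :=
  (∀ i, IsInterval (A i)) ∧ (∀ i j, i ≠ j → Disjoint (A i) (A j)) ∧
    ∀ v : Fin m, ∃ i, v ∈ A i

/-- EF1 (envy-freeness up to one outer good) on a path. -/
def EF1 {n m : ℕ} (u : Fin n → Finset (Fin m) → ℝ) (A : Fin n → Finset (Fin m)) : Prop :=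
  ∀ i j : Fin n, A j = ∅ ∨
    ∃ v ∈ A j, IsInterval (A j \ {v}) ∧ u i (A j \ {v}) ≤ u i (A i)

/-- The bundle of items that the assignment `g` gives to agent `j`. -/
def bundle {n m : ℕ} (g : Fin m → Fin n) (j : Fin n) : Finset (Fin m) :=
  Finset.univ.filter fun v => g v = j

lemma mem_bundle {n m : ℕ} {g : Fin m → Fin n} {j : Fin n} {v : Fin m} :
    v ∈ bundle g j ↔ g v = j := by
  simp [bundle]

lemma isInterval_bundle {n m : ℕ} {g : Fin m → Fin n} (hg : Monotone g) (j : Fin n) :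
    IsInterval (bundle g j) := by
  intro a b c hab hbc ha hc
  rw [mem_bundle] at *
  exact le_antisymm (hc ▸ hg hbc) (ha ▸ hg hab)

lemma isConnAlloc_bundle {n m : ℕ} {g : Fin m → Fin n} (hg : Monotone g) :
    IsConnAlloc (bundle g) := by
  refine ⟨isInterval_bundle hg, fun i j hij => ?_, fun v => ⟨g v, mem_bundle.2 rfl⟩⟩
  rw [Finset.disjoint_left]
  intro v hi hj
  rw [mem_bundle] at hi hj
  exact hij (hi.symm.trans hj)

lemma IsInterval.sdiff_max {m : ℕ} {I : Finset (Fin m)} (hI : IsInterval I) {v : Fin m}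
    (hv : ∀ w ∈ I, w ≤ v) : IsInterval (I \ {v}) := by
  intro a b c hab hbc ha hc
  simp only [Finset.mem_sdiff, Finset.mem_singleton] at *
  exact ⟨hI a b c hab hbc ha.1 hc.1,
    fun h => hc.2 (le_antisymm (hv c hc.1) (h ▸ hbc))⟩

lemma IsInterval.sdiff_min {m : ℕ} {I : Finset (Fin m)} (hI : IsInterval I) {v : Fin m}
    (hv : ∀ w ∈ I, v ≤ w) : IsInterval (I \ {v}) := by
  intro a b c hab hbc ha hc
  simp only [Finset.mem_sdiff, Finset.mem_singleton] at *
  exact ⟨hI a b c hab hbc ha.1 hc.1,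
    fun h => ha.2 (le_antisymm (h ▸ hab) (hv a ha.1))⟩

/-- The agents whose bundle is worth exactly as much as that of agent `i`. -/
noncomputable def tiedAgents {n m : ℕ} (u : Finset (Fin m) → ℝ) (g : Fin m → Fin n)
    (i : Fin n) : Finset (Fin n) :=
  Finset.univ.filter fun j => u (bundle g j) = u (bundle g i)

/-- The total distance of the items, measured in bundles, from the bundle of agent `i`. -/
def totalDist {n m : ℕ} (g : Fin m → Fin n) (i : Fin n) : ℕ :=
  ∑ v, Nat.dist (g v) i

/-- `g` is a connected assignment in which agent `i` is worst off. -/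
def IsWorstOff {n m : ℕ} (u : Finset (Fin m) → ℝ) (g : Fin m → Fin n) (i : Fin n) : Prop :=
  Monotone g ∧ ∀ j, u (bundle g i) ≤ u (bundle g j)

/-- The cost of an assignment with worst-off agent `i`: prefer a large minimum value, then few
agents attaining it, then items close to agent `i`. -/
noncomputable def cost {n m : ℕ} (u : Finset (Fin m) → ℝ) (g : Fin m → Fin n) (i : Fin n) :
    ℝ ×ₗ (ℕ ×ₗ ℕ) :=
  toLex (-u (bundle g i), toLex ((tiedAgents u g i).card, totalDist g i))

lemma exists_isWorstOff {n m : ℕ} (hn : 0 < n) (u : Finset (Fin m) → ℝ) {g : Fin m → Fin n}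
    (hg : Monotone g) : ∃ i, IsWorstOff u g i := by
  obtain ⟨i, -, hi⟩ := Finset.exists_min_image Finset.univ (fun j => u (bundle g j))
    ⟨⟨0, hn⟩, Finset.mem_univ _⟩
  exact ⟨i, hg, fun j => hi j (Finset.mem_univ _)⟩

lemma exists_cost_minimal {n m : ℕ} (hn : 0 < n) (u : Finset (Fin m) → ℝ) :
    ∃ (g : Fin m → Fin n) (i : Fin n), IsWorstOff u g i ∧
      ∀ (g' : Fin m → Fin n) (i' : Fin n), IsWorstOff u g' i' → cost u g i ≤ cost u g' i' := by
  let S : Set ((Fin m → Fin n) × Fin n) := {p | IsWorstOff u p.1 p.2}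
  obtain ⟨i₀, hi₀⟩ := exists_isWorstOff (m := m) hn u (g := fun _ => ⟨0, hn⟩) monotone_const
  obtain ⟨⟨g, i⟩, hgi, hmin⟩ := Set.exists_min_image S (fun p => cost u p.1 p.2)
    (Set.toFinite S) ⟨(_, i₀), hi₀⟩
  exact ⟨g, i, hgi, fun g' i' h => hmin (g', i') h⟩

/-- In a cost-minimal assignment, an item that could be moved to a bundle closer to that of the
worst-off agent `i` leaves behind a bundle that `i` does not envy. -/
lemma le_of_cost_minimal {n m : ℕ} {u : Finset (Fin m) → ℝ} (hmono : Monotonic u)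
    {g : Fin m → Fin n} {i : Fin n} (hgi : IsWorstOff u g i)
    (hmin : ∀ (g' : Fin m → Fin n) (i' : Fin n), IsWorstOff u g' i' → cost u g i ≤ cost u g' i')
    {v : Fin m} {k : Fin n} (hmon : Monotone (Function.update g v k))
    (hdist : Nat.dist k i < Nat.dist (g v) i) :
    u (bundle g (g v) \ {v}) ≤ u (bundle g i) := by
  by_contra! hlt
  set g' := Function.update g v k with hg'
  have hkv : k ≠ g v := by rintro rfl; exact lt_irrefl _ hdist
  have hv' : bundle g' (g v) = bundle g (g v) \ {v} := by
    ext w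
    simp only [mem_bundle, Finset.mem_sdiff, Finset.mem_singleton, hg']
    by_cases hw : w = v
    · subst hw; simp [hkv]
    · simp [hw]
  have hsub : ∀ j, j ≠ g v → u (bundle g j) ≤ u (bundle g' j) := by
    intro j hj
    refine hmono _ _ fun w hw => ?_
    rw [mem_bundle] at hw ⊢
    have hwv : w ≠ v := by rintro rfl; exact hj hw.symm
    simpa [hg', hwv] using hw
  have hge : ∀ j, u (bundle g i) ≤ u (bundle g' j) := by
    intro j
    by_cases hj : j = g v
    · rw [hj, hv']; exact hlt.le
    · exact (hgi.2 j).trans (hsub j hj)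
  have heq : ∀ j, u (bundle g' j) = u (bundle g i) → u (bundle g j) = u (bundle g i) := by
    intro j h
    by_cases hj : j = g v
    · rw [hj, hv'] at h; exact absurd h hlt.ne'
    · exact le_antisymm ((hsub j hj).trans h.le) (hgi.2 j)
  obtain ⟨i', hi'⟩ := exists_isWorstOff (Fin.pos i) u hmon
  have hval : u (bundle g' i') = u (bundle g i) := by
    have h := hmin g' i' hi'
    simp only [cost, Prod.Lex.toLex_le_toLex] at h
    have := hge i'
    rcases h with h | h <;> linarith [h]
  have htied : ∀ l, u (bundle g' l) = u (bundle g i) → tiedAgents u g' l ⊆ tiedAgents u g i := by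
    intro l hl j hj
    simp only [tiedAgents, Finset.mem_filter, Finset.mem_univ, true_and] at hj ⊢
    exact heq j (hj.trans hl)
  by_cases hi : u (bundle g' i) = u (bundle g i)
  · have h := hmin g' i ⟨hmon, fun j => hi ▸ hge j⟩
    have hd : totalDist g' i < totalDist g i := by
      refine Finset.sum_lt_sum (fun w _ => ?_) ⟨v, Finset.mem_univ _, by simpa [hg'] using hdist⟩
      by_cases hw : w = v
      · subst hw; simpa [hg'] using hdist.le
      · simp [hg', hw]
    have hc := Finset.card_le_card (htied i hi)
    simp only [cost, Prod.Lex.toLex_le_toLex, hi, lt_irrefl, false_or, true_and] at h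
    omega
  · have h := hmin g' i' hi'
    have hc : (tiedAgents u g' i').card < (tiedAgents u g i).card := by
      refine Finset.card_lt_card ((Finset.ssubset_iff_of_subset (htied i' hval)).2 ⟨i, ?_, ?_⟩)
      · simp [tiedAgents]
      · simpa [tiedAgents, hval] using hi
    simp only [cost, Prod.Lex.toLex_le_toLex, hval, lt_irrefl, false_or, true_and] at h
    omega

lemma monotone_update {n m : ℕ} {g : Fin m → Fin n} (hg : Monotone g) {v : Fin m} {k : Fin n}
    (hlt : ∀ w, w < v → g w ≤ k) (hgt : ∀ w, v < w → k ≤ g w) :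
    Monotone (Function.update g v k) := by
  intro a b hab
  by_cases ha : a = v <;> by_cases hb : b = v
  · simp [ha, hb]
  · subst ha
    simpa [hb] using hgt b (lt_of_le_of_ne hab (Ne.symm hb))
  · subst hb
    simpa [ha] using hlt a (lt_of_le_of_ne hab ha)
  · simpa [ha, hb] using hg hab

/-- on a path of `m` items, for any number `n ≥ 1` of agents with identical
monotonic valuations (all agents share the valuation `u`), a connected EF1 allocation
exists. -/
theorem EF1_exists_identical {n m : ℕ} (hn : 0 < n)
    (u : Finset (Fin m) → ℝ) (hmono : Monotonic u) (h0 : u ∅ = 0) :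
    ∃ A : Fin n → Finset (Fin m), IsConnAlloc A ∧ EF1 (fun _ => u) A := by
  obtain ⟨g, i, hgi, hmin⟩ := exists_cost_minimal (m := m) hn u
  refine ⟨bundle g, isConnAlloc_bundle hgi.1, fun l j => ?_⟩
  refine (bundle g j).eq_empty_or_nonempty.imp_right fun hne => ?_
  suffices h : ∃ v ∈ bundle g j, IsInterval (bundle g j \ {v}) ∧
      u (bundle g j \ {v}) ≤ u (bundle g i) by
    obtain ⟨v, hv, hint, hle⟩ := h
    exact ⟨v, hv, hint, hle.trans (hgi.2 l)⟩
  have hint := isInterval_bundle hgi.1 j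
  rcases lt_trichotomy j i with hji | rfl | hij
  · obtain ⟨v, hv, hmax⟩ := Finset.exists_max_image _ id hne
    refine ⟨v, hv, hint.sdiff_max hmax, ?_⟩
    obtain rfl := mem_bundle.1 hv
    refine le_of_cost_minimal hmono hgi hmin
      (k := ⟨(g v : ℕ) + 1, by have := i.isLt; omega⟩)
      (monotone_update hgi.1 (fun w hw => ?_) (fun w hw => ?_)) ?_
    · have := hgi.1 hw.le
      rw [Fin.le_def] at this ⊢
      exact this.trans (Nat.le_succ _)
    · have hne' : g v ≠ g w := fun h => absurd (hmax w (mem_bundle.2 h.symm)) (not_le.2 hw)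
      exact Fin.lt_def.1 (lt_of_le_of_ne (hgi.1 hw.le) hne')
    · simp only [Nat.dist]
      omega
  · obtain ⟨v, hv, hmax⟩ := Finset.exists_max_image _ id hne
    exact ⟨v, hv, hint.sdiff_max hmax, hmono _ _ Finset.sdiff_subset⟩
  · obtain ⟨v, hv, hmin'⟩ := Finset.exists_min_image _ id hne
    refine ⟨v, hv, hint.sdiff_min hmin', ?_⟩
    obtain rfl := mem_bundle.1 hv
    refine le_of_cost_minimal hmono hgi hmin
      (k := ⟨(g v : ℕ) - 1, by have := (g v).isLt; omega⟩)
      (monotone_update hgi.1 (fun w hw => ?_) (fun w hw => ?_)) ?_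
    · have hne' : g w ≠ g v := fun h => absurd (hmin' w (mem_bundle.2 h)) (not_le.2 hw)
      exact Nat.le_sub_one_of_lt (Fin.lt_def.1 (lt_of_le_of_ne (hgi.1 hw.le) hne'))
    · have := hgi.1 hw.le
      rw [Fin.le_def] at this ⊢
      exact (Nat.sub_le _ _).trans this
    · simp only [Nat.dist]
      omega
end

section
/- On a path of m items with n agents whose valuations are monotonic and subadditive, every connected EF1 allocation A is 1/3-MMS: for every agent i, u_i(A(i)) ≥ (1/3)·MMS_i. -/
/-- The maximin share of an agent with valuation `u`, for `n` agents: the maximum, over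
all partitions of the path into `n` connected bundles, of the minimum value of a bundle. -/
noncomputable def MMS (n : ℕ) {m : ℕ} (u : Finset (Fin m) → ℝ) : ℝ :=
  sSup {x : ℝ | ∃ P : Fin n → Finset (Fin m),
    IsConnAlloc P ∧ x = sInf (Set.range fun j => u (P j))}

/-- A valuation is subadditive if `u (X ∪ Y) ≤ u X + u Y`. -/
def SubadditiveVal {m : ℕ} (u : Finset (Fin m) → ℝ) : Prop :=
  ∀ X Y : Finset (Fin m), u (X ∪ Y) ≤ u X + u Y

/-- If each index `j` marks at most one item (those `v` with `M j v`), then some bundle of a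
connected allocation `P` contains no item marked by an index other than `i`. -/
theorem exists_bundle_avoiding {n m : ℕ} {P : Fin n → Finset (Fin m)} (hP : IsConnAlloc P)
    (i : Fin n) (M : Fin n → Fin m → Prop) (hM : ∀ j v w, M j v → M j w → v = w) :
    ∃ k, ∀ j, j ≠ i → ∀ v, M j v → v ∉ P k := by
  by_contra! h
  choose f hf v hv hvP using h
  have hinj : Function.Injective f := by
    intro k l hkl
    by_contra hne
    have hvl := hv l
    rw [← hkl] at hvl
    exact Finset.disjoint_left.mp (hP.2.1 k l hne) (hvP k) (hM _ _ _ (hv k) hvl ▸ hvP l)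
  obtain ⟨k, hk⟩ := (Finite.injective_iff_surjective.mp hinj) i
  exact hf k hk

/-- If `x` lies between two items `l`, `r` of an interval `I`, then an interval through `x`
contains `l`, contains `r`, or is contained in `I`. -/
theorem IsInterval.mem_end_or_subset {m : ℕ} {I J : Finset (Fin m)} (hI : IsInterval I)
    (hJ : IsInterval J) {l r x : Fin m} (hl : l ∈ I) (hr : r ∈ I) (hlx : l ≤ x) (hxr : x ≤ r)
    (hxJ : x ∈ J) : l ∈ J ∨ r ∈ J ∨ J ⊆ I := by
  by_contra! h
  obtain ⟨hlJ, hrJ, hsub⟩ := h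
  refine hsub fun y hy => hI l y r ?_ ?_ hl hr
  · by_contra! hyl
    exact hlJ (hJ y l x hyl.le hlx hy hxJ)
  · by_contra! hry
    exact hrJ (hJ x r y hxr hry.le hxJ hy)

/-- on a path, for `n ≥ 1` agents with monotonic subadditive valuations,
every connected EF1 allocation gives each agent at least one third of their maximin
share. -/
theorem EF1_implies_third_MMS {n m : ℕ} (hn : 0 < n)
    (u : Fin n → Finset (Fin m) → ℝ)
    (hmono : ∀ i, Monotonic (u i)) (hsub : ∀ i, SubadditiveVal (u i))
    (h0 : ∀ i, u i ∅ = 0)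
    (A : Fin n → Finset (Fin m)) (hA : IsConnAlloc A) (hEF1 : EF1 u A) :
    ∀ i : Fin n, (1 / 3 : ℝ) * MMS n (u i) ≤ u i (A i) := by
  intro i
  have hnonneg : 0 ≤ u i (A i) := h0 i ▸ hmono i ∅ (A i) (Finset.empty_subset _)
  suffices h : MMS n (u i) ≤ 3 * u i (A i) by linarith
  refine Real.sSup_le ?_ (by linarith)
  rintro x ⟨P, hP, rfl⟩
  have hEF : ∀ j, A j ≠ ∅ → ∃ v ∈ A j, u i (A j \ {v}) ≤ u i (A i) := fun j hj =>
    ((hEF1 i j).resolve_left hj).imp fun v hv => ⟨hv.1, hv.2.2⟩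
  choose v hvA hvu using hEF
  obtain ⟨k, hk⟩ := exists_bundle_avoiding hP i (fun j w => ∃ hj : A j ≠ ∅, w = v j hj)
    (by rintro j _ _ ⟨_, rfl⟩ ⟨_, rfl⟩; rfl)
  have hvk : ∀ j, j ≠ i → ∀ hj : A j ≠ ∅, v j hj ∉ P k := fun j hji hj => hk j hji _ ⟨hj, rfl⟩
  refine (csInf_le (Set.finite_range _).bddBelow ⟨k, rfl⟩).trans ?_
  change u i (P k) ≤ _
  have hinter : ∀ j, u i (P k ∩ A j) ≤ u i (A i) := by
    intro j
    by_cases hji : j = i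
    · exact hji ▸ hmono i _ _ Finset.inter_subset_right
    by_cases hj : A j = ∅
    · simpa [hj, h0] using hnonneg
    refine (hmono i _ _ fun y hy => ?_).trans (hvu j hj)
    rw [Finset.mem_inter] at hy
    rw [Finset.mem_sdiff, Finset.mem_singleton]
    exact ⟨hy.2, fun h => hvk j hji hj (h ▸ hy.1)⟩
  rcases (P k).eq_empty_or_nonempty with hempty | hne
  · rw [hempty, h0]
    linarith
  obtain ⟨a, ha⟩ := hA.2.2 ((P k).min' hne)
  obtain ⟨b, hb⟩ := hA.2.2 ((P k).max' hne)
  have hcover : P k ⊆ (P k ∩ A a ∪ P k ∩ A i) ∪ P k ∩ A b := by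
    intro x hx
    obtain ⟨c, hc⟩ := hA.2.2 x
    have hunique : ∀ y d, y ∈ A c → y ∈ A d → c = d := fun y d hyc hyd => by
      by_contra hcd
      exact Finset.disjoint_left.mp (hA.2.1 c d hcd) hyc hyd
    simp only [Finset.mem_union, Finset.mem_inter, hx, true_and]
    by_cases hci : c = i
    · exact Or.inl (Or.inr (hci ▸ hc))
    rcases (hP.1 k).mem_end_or_subset (hA.1 c) ((P k).min'_mem hne) ((P k).max'_mem hne)
      ((P k).min'_le x hx) ((P k).le_max' x hx) hc with h | h | h
    · exact Or.inl (Or.inl (hunique _ a h ha ▸ hc))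
    · exact Or.inr (hunique _ b h hb ▸ hc)
    · exact absurd (h (hvA c (Finset.ne_empty_of_mem hc))) (hvk c hci _)
  have h₁ := hmono i _ _ hcover
  have h₂ := hsub i (P k ∩ A a ∪ P k ∩ A i) (P k ∩ A b)
  have h₃ := hsub i (P k ∩ A a) (P k ∩ A i)
  linarith [hinter a, hinter i, hinter b]
end

section
/- On a path of m items with n ≥ 2 agents whose valuations are monotonic and subadditive, in every connected EF1 allocation, each of the two agents receiving the leftmost and the rightmost bundle of the path obtains at least half of their maximin share: if agent i receives the bundle containing v_1 or the bundle containing v_m, then u_i(A(i)) ≥ (1/2)·MMS_i. -/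
/-- An interval that avoids two items and contains an item between them lies strictly between
them. -/
theorem IsInterval.lt_and_lt_of_mem {m : ℕ} {I : Finset (Fin m)} (hI : IsInterval I)
    {x y z w : Fin m} (hxy : x ≤ y) (hyz : y ≤ z) (hx : x ∉ I) (hy : y ∈ I) (hz : z ∉ I)
    (hw : w ∈ I) : x < w ∧ w < z := by
  constructor
  · by_contra! h
    exact hx (hI w x y h hxy hw hy)
  · by_contra! h
    exact hz (hI y z w hyz h hy hw)

/-- Suppose bundle `i` lies at an end of the path and every nonempty bundle `A j` without its item
`v j` is worth at most `u (A i)`. Then an interval worth more than `2 * u (A i)` contains some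
`v j` with `j ≠ i`, since otherwise it would meet at most two bundles. -/
theorem exists_mem_of_two_mul_lt {n m : ℕ} (hm : 0 < m) {u : Finset (Fin m) → ℝ}
    (hmono : Monotonic u) (hsub : SubadditiveVal u) (h0 : u ∅ = 0)
    {A : Fin n → Finset (Fin m)} (hA : IsConnAlloc A) {i : Fin n}
    (hi : (⟨0, hm⟩ : Fin m) ∈ A i ∨ (⟨m - 1, Nat.sub_lt hm Nat.one_pos⟩ : Fin m) ∈ A i)
    {v : Fin n → Fin m} (hv : ∀ j, A j ≠ ∅ → v j ∈ A j ∧ u (A j \ {v j}) ≤ u (A i))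
    {P : Finset (Fin m)} (hP : IsInterval P) (hlt : 2 * u (A i) < u P) :
    ∃ j, j ≠ i ∧ v j ∈ P := by
  by_contra! hno
  obtain ⟨hint, hdisj, hcov⟩ := hA
  have ha : 0 ≤ u (A i) := h0 ▸ hmono _ _ (Finset.empty_subset _)
  rcases P.eq_empty_or_nonempty with rfl | hne
  · linarith
  obtain ⟨j, hj⟩ := hcov (P.min' hne)
  obtain ⟨k, hk⟩ := hcov (P.max' hne)
  have hpiece : ∀ l, u (P ∩ A l) ≤ u (A i) := by
    intro l
    rcases eq_or_ne l i with rfl | hl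
    · exact hmono _ _ Finset.inter_subset_right
    rcases (A l).eq_empty_or_nonempty with h | h
    · simpa [h, h0] using ha
    refine (hmono _ _ fun x hx => ?_).trans (hv l h.ne_empty).2
    rw [Finset.mem_inter] at hx
    rw [Finset.mem_sdiff, Finset.mem_singleton]
    exact ⟨hx.2, fun hxv => hno l hl (hxv ▸ hx.1)⟩
  have hcover : P ⊆ (P ∩ A j) ∪ (P ∩ A k) := by
    intro y hy
    obtain ⟨l, hl⟩ := hcov y
    rcases eq_or_ne l j with rfl | hlj
    · simp [hy, hl]
    rcases eq_or_ne l k with rfl | hlk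
    · simp [hy, hl]
    have hbetween : ∀ w ∈ A l, P.min' hne < w ∧ w < P.max' hne := fun w hw =>
      (hint l).lt_and_lt_of_mem (P.min'_le y hy) (P.le_max' y hy)
        (fun h => Finset.disjoint_left.1 (hdisj l j hlj) h hj) hl
        (fun h => Finset.disjoint_left.1 (hdisj l k hlk) h hk) hw
    rcases eq_or_ne l i with rfl | hli
    · rcases hi with h | h
      · have := (hbetween _ h).1
        simp [Fin.lt_def] at this
      · have := (hbetween _ h).2
        rw [Fin.lt_def] at this
        have := (P.max' hne).isLt
        simp only at *
        omega
    · have hvl := (hv l (Finset.ne_empty_of_mem hl)).1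
      have hb := hbetween _ hvl
      exact absurd (hP _ _ _ hb.1.le hb.2.le (P.min'_mem hne) (P.max'_mem hne)) (hno l hli)
  linarith [hmono _ _ hcover, hsub (P ∩ A j) (P ∩ A k), hpiece j, hpiece k]

/-- on a path of `m ≥ 1` items with `n ≥ 2` agents whose valuations are
monotonic and subadditive, in every connected EF1 allocation, any agent receiving the
bundle containing the leftmost item `v_1` or the bundle containing the rightmost item
`v_m` obtains at least half of their maximin share. -/
theorem EF1_outer_bundle_half_MMS {n m : ℕ} (hn : 2 ≤ n) (hm : 0 < m)
    (u : Fin n → Finset (Fin m) → ℝ)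
    (hmono : ∀ i, Monotonic (u i)) (hsub : ∀ i, SubadditiveVal (u i))
    (h0 : ∀ i, u i ∅ = 0)
    (A : Fin n → Finset (Fin m)) (hA : IsConnAlloc A) (hEF1 : EF1 u A)
    (i : Fin n)
    (hi : (⟨0, hm⟩ : Fin m) ∈ A i ∨ (⟨m - 1, Nat.sub_lt hm Nat.one_pos⟩ : Fin m) ∈ A i) :
    (1 / 2 : ℝ) * MMS n (u i) ≤ u i (A i) := by
  have ha : 0 ≤ u i (A i) := h0 i ▸ hmono i _ _ (Finset.empty_subset _)
  suffices h : MMS n (u i) ≤ 2 * u i (A i) by linarith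
  have hex : ∀ j, ∃ v, A j ≠ ∅ → v ∈ A j ∧ u i (A j \ {v}) ≤ u i (A i) := by
    intro j
    rcases hEF1 i j with h | ⟨v, hv, -, huv⟩
    · exact ⟨⟨0, hm⟩, fun h' => absurd h h'⟩
    · exact ⟨v, fun _ => ⟨hv, huv⟩⟩
  choose v hv using hex
  refine Real.sSup_le ?_ (by linarith)
  rintro x ⟨P, ⟨hPint, hPdisj, -⟩, rfl⟩
  by_contra! hlt
  have hbig : ∀ k, 2 * u i (A i) < u i (P k) := fun k =>
    hlt.trans_le (csInf_le (Set.finite_range _).bddBelow ⟨k, rfl⟩)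
  choose f hfi hf using fun k =>
    exists_mem_of_two_mul_lt hm (hmono i) (hsub i) (h0 i) hA hi hv (hPint k) (hbig k)
  have hinj : Function.Injective f := by
    intro k l hkl
    by_contra hne
    exact Finset.disjoint_left.1 (hPdisj k l hne) (hf k) (hkl ▸ hf l)
  obtain ⟨k, hk⟩ := Finite.injective_iff_surjective.1 hinj i
  exact hfi k hk
end

section
/- Without subadditivity, EF1 on a path does not guarantee any positive fraction of the maximin share: there exist monotonic valuations for two agents over a path of three items v_1, v_2, v_3 (namely the identical valuation u with u(I) = 1 if I ⊇ {v_1,v_2} or I ⊇ {v_3}, and u(I) = 0 otherwise) and a connected EF1 allocation A (namely ({v_1}, {v_2,v_3})) in which some agent i has u_i(A(i)) = 0 while MMS_i = 1; hence for every α > 0 the allocation fails α-MMS. -/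
/-- The witnessing valuation: a bundle is worth `1` when it contains the first two items or the
third one, and `0` otherwise. -/
noncomputable def complementsValuation (I : Finset (Fin 3)) : ℝ :=
  if ({0, 1} : Finset (Fin 3)) ⊆ I ∨ (2 : Fin 3) ∈ I then 1 else 0

theorem complementsValuation_le_one (I : Finset (Fin 3)) : complementsValuation I ≤ 1 := by
  unfold complementsValuation
  split_ifs <;> norm_num

theorem monotonic_complementsValuation : Monotonic complementsValuation := by
  intro X Y hXY
  by_cases hX : ({0, 1} : Finset (Fin 3)) ⊆ X ∨ (2 : Fin 3) ∈ X
  · have hY : ({0, 1} : Finset (Fin 3)) ⊆ Y ∨ (2 : Fin 3) ∈ Y :=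
      hX.imp (fun h => h.trans hXY) (fun h => hXY h)
    simp only [complementsValuation, if_pos hX, if_pos hY, le_refl]
  · simp only [complementsValuation, if_neg hX]
    split_ifs <;> norm_num

theorem MMS_complementsValuation : MMS 2 complementsValuation = 1 := by
  refine IsGreatest.csSup_eq ⟨⟨![{0, 1}, {2}], ?_, ?_⟩, ?_⟩
  · unfold IsConnAlloc IsInterval
    decide
  · have h : (fun j => complementsValuation ((![{0, 1}, {2}] : Fin 2 → Finset (Fin 3)) j)) =
        fun _ => 1 := by
      funext j
      fin_cases j <;> simp [complementsValuation]
    rw [h, Set.range_const, csInf_singleton]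
  · rintro x ⟨P, -, rfl⟩
    exact (csInf_le (Set.finite_range _).bddBelow (Set.mem_range_self 0)).trans
      (complementsValuation_le_one (P 0))

theorem EF1_complementsValuation :
    EF1 (fun _ : Fin 2 => complementsValuation) ![{0}, {1, 2}] := by
  have h_zero : ∀ X : Finset (Fin 3), ¬ (({0, 1} : Finset (Fin 3)) ⊆ X ∨ (2 : Fin 3) ∈ X) →
      ∀ Y, complementsValuation X ≤ complementsValuation Y := by
    intro X hX Y
    simp only [complementsValuation, if_neg hX]
    split_ifs <;> norm_num
  intro i j
  right
  fin_cases j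
  · exact ⟨0, by decide, by unfold IsInterval; decide, h_zero _ (by decide) _⟩
  · exact ⟨2, by decide, by unfold IsInterval; decide, h_zero _ (by decide) _⟩

/-- without subadditivity, EF1 on a path does not guarantee any positive
fraction of the maximin share. On the path of three items `v₁ = 0`, `v₂ = 1`, `v₃ = 2`
(two agents), the identical monotonic valuation `u` with `u I = 1` iff `{v₁,v₂} ⊆ I` or
`v₃ ∈ I` (and `u I = 0` otherwise) admits the connected EF1 allocation
`({v₁}, {v₂, v₃})` in which agent 0 gets value 0 while `MMS = 1`; hence the allocation
fails `α`-MMS for every `α > 0`. -/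
theorem EF1_no_MMS_fraction_without_subadditivity :
    ∃ (u : Finset (Fin 3) → ℝ) (A : Fin 2 → Finset (Fin 3)),
      (∀ I : Finset (Fin 3),
        u I = if ({0, 1} : Finset (Fin 3)) ⊆ I ∨ (2 : Fin 3) ∈ I then 1 else 0) ∧
      Monotonic u ∧ u ∅ = 0 ∧
      A 0 = {0} ∧ A 1 = {1, 2} ∧
      IsConnAlloc A ∧ EF1 (fun _ => u) A ∧
      u (A 0) = 0 ∧ MMS 2 u = 1 ∧
      ∀ α : ℝ, 0 < α → u (A 0) < α * MMS 2 u := by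
  have h_zero : complementsValuation {0} = 0 := if_neg (by decide)
  refine ⟨complementsValuation, ![{0}, {1, 2}], fun _ => rfl, monotonic_complementsValuation,
    if_neg (by decide), rfl, rfl, ?_, EF1_complementsValuation, h_zero,
    MMS_complementsValuation, fun α hα => ?_⟩
  · unfold IsConnAlloc IsInterval
    decide
  · rw [MMS_complementsValuation, mul_one]
    exact h_zero.trans_lt hα
end

section
/- Suppose there are n ≥ 2 agents and m items arranged on a path. Take any n−1 items y^1 < ⋯ < y^{n−1} (in path order) and define the n bundles B^1 = {items strictly left of y^1}, B^j = {items strictly between y^{j−1} and y^j} for 2 ≤ j ≤ n−1, and B^n = {items strictly right of y^{n−1}}. Then for every agent i with a monotonic valuation u_i, there exists some r ∈ {1,…,n} with u_i(B^r) ≥ MMS_i. -/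
/-- An item that is not one of the cuts `y` lies strictly between two consecutive cuts. -/
theorem exists_gap_of_notMem_range {k m : ℕ} {y : Fin k → Fin m} (hy : StrictMono y)
    {v : Fin m} (hv : ∀ a, y a ≠ v) :
    ∃ r ≤ k, (∀ a : Fin k, (a : ℕ) < r → y a < v) ∧ ∀ a : Fin k, r ≤ (a : ℕ) → v < y a := by
  classical
  have hex : ∃ r : ℕ, ∀ a : Fin k, r ≤ (a : ℕ) → v < y a :=
    ⟨k, fun a ha => absurd a.isLt (not_lt.mpr ha)⟩
  refine ⟨Nat.find hex, Nat.find_min' hex fun a ha => absurd a.isLt (not_lt.mpr ha),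
    fun a ha => ?_, Nat.find_spec hex⟩
  have hmin := Nat.find_min hex ha
  push Not at hmin
  obtain ⟨b, hab, hb⟩ := hmin
  exact lt_of_le_of_ne ((hy.monotone (Fin.le_def.mpr hab)).trans hb) (hv a)

/-- Among `n` disjoint bundles, some bundle contains none of `n - 1` given items. -/
theorem IsConnAlloc.exists_avoiding {n m : ℕ} (hn : 0 < n) {P : Fin n → Finset (Fin m)}
    (hP : IsConnAlloc P) (y : Fin (n - 1) → Fin m) : ∃ j, ∀ a, y a ∉ P j := by
  by_contra! hcon
  choose f hf using hcon
  have hinj : Function.Injective f := by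
    intro i j hij
    by_contra hne
    exact Finset.disjoint_left.mp (hP.2.1 i j hne) (hf i) (hij ▸ hf j)
  have hcard := Fintype.card_le_of_injective f hinj
  simp only [Fintype.card_fin] at hcard
  omega

/-- with `n ≥ 2` agents and `m` items on a path, take any `n - 1` items
`y 0 < y 1 < ⋯` (in path order) and form the `n` bundles `B r` consisting of the items
strictly between `y (r-1)` and `y r` (with `B 0` the items strictly left of `y 0` and
`B (n-1)` the items strictly right of the last `y`). Then every agent with a monotonic
valuation values some bundle `B r` at least at their maximin share. -/
theorem bundle_between_cuts_MMS {n m : ℕ} (hn : 2 ≤ n)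
    (u : Finset (Fin m) → ℝ) (hmono : Monotonic u) (h0 : u ∅ = 0)
    (y : Fin (n - 1) → Fin m) (hy : StrictMono y)
    (B : Fin n → Finset (Fin m))
    (hB : ∀ r : Fin n, B r = Finset.univ.filter (fun v =>
        (∀ a : Fin (n - 1), (a : ℕ) < (r : ℕ) → y a < v) ∧
        (∀ a : Fin (n - 1), (r : ℕ) ≤ (a : ℕ) → v < y a))) :
    ∃ r : Fin n, MMS n u ≤ u (B r) := by
  have : Nonempty (Fin n) := ⟨⟨0, by omega⟩⟩
  obtain ⟨r, hr⟩ := Finite.exists_max fun r => u (B r)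
  have hnonneg : 0 ≤ u (B r) := h0 ▸ hmono ∅ (B r) (Finset.empty_subset _)
  refine ⟨r, Real.sSup_le ?_ hnonneg⟩
  rintro x ⟨P, hP, rfl⟩
  obtain ⟨j, hj⟩ := hP.exists_avoiding (by omega) y
  refine (csInf_le (Set.finite_range _).bddBelow (Set.mem_range_self j)).trans ?_
  rcases (P j).eq_empty_or_nonempty with hempty | ⟨v, hv⟩
  · simpa [hempty, h0] using hnonneg
  obtain ⟨s, hs, hlt, hgt⟩ := exists_gap_of_notMem_range hy (v := v) fun a h => hj a (h ▸ hv)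
  refine le_trans (hmono _ _ fun w hw => ?_) (hr ⟨s, by omega⟩)
  rw [hB, Finset.mem_filter]
  refine ⟨Finset.mem_univ w, fun a ha => ?_, fun a ha => ?_⟩
  · by_contra! h
    exact hj a (hP.1 j w (y a) v h (hlt a ha).le hw hv)
  · by_contra! h
    exact hj a (hP.1 j v (y a) w (hgt a ha).le h hv hw)
end

section
/- On a path of m items, for any number n of agents with monotonic valuations, there exists a connected allocation that is simultaneously EF2 and MMS, i.e., it is EF2 and gives every agent i a bundle of value u_i at least MMS_i. -/
/-- EF2 (envy-freeness up to two outer goods) on a path. -/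
def EF2 {n m : ℕ} (u : Fin n → Finset (Fin m) → ℝ) (A : Fin n → Finset (Fin m)) : Prop :=
  ∀ i j : Fin n, (A j).card ≤ 1 ∨
    ∃ v ∈ A j, ∃ w ∈ A j, v ≠ w ∧ IsInterval (A j \ {v, w}) ∧
      u i (A j \ {v, w}) ≤ u i (A i)

/-- Moving one unit from coordinate `a` to its cyclic predecessor. -/
def transfer {k : ℕ} (a : Fin (k + 1)) : Fin (k + 1) → ℤ :=
  fun j => (if j + 1 = a then 1 else 0) - (if j = a then 1 else 0)

theorem sum_transfer {k : ℕ} (a : Fin (k + 1)) : ∑ j, transfer a j = 0 := by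
  have h : ∀ j : Fin (k + 1), j + 1 = a ↔ j = a - 1 := fun j => eq_sub_iff_add_eq.symm
  simp [transfer, h]

/-- A top-dimensional cell of the triangulation of the simplex
`{l | 0 ≤ l, ∑ j, l j = M}`, given as a cyclic sequence `v` of vertices, where
the step from `v t` to `v (t + 1)` is `transfer (σ t)`. -/
structure IsCell {k : ℕ} (M : ℤ) (v : Fin (k + 1) → Fin (k + 1) → ℤ)
    (σ : Fin (k + 1) → Fin (k + 1)) : Prop where
  injective : Function.Injective σ
  nonneg : ∀ t, 0 ≤ v t
  sum_eq : ∀ t, ∑ j, v t j = M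
  step : ∀ t, v (t + 1) = v t + transfer (σ t)

theorem IsCell.rotate {k : ℕ} {M : ℤ} {v : Fin (k + 1) → Fin (k + 1) → ℤ}
    {σ : Fin (k + 1) → Fin (k + 1)} (h : IsCell M v σ) (s : Fin (k + 1)) :
    IsCell M (fun t => v (t + s)) (fun t => σ (t + s)) where
  injective := fun a b hab => add_right_cancel (h.injective hab)
  nonneg t := h.nonneg _
  sum_eq t := h.sum_eq _
  step t := by
    have := h.step (t + s)
    rw [← this, add_right_comm]

theorem finite_setOf_isCell (k : ℕ) (M : ℤ) :
    {c : (Fin (k + 1) → Fin (k + 1) → ℤ) × (Fin (k + 1) → Fin (k + 1)) |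
      IsCell M c.1 c.2}.Finite := by
  refine ((Set.finite_Icc (0 : Fin (k + 1) → Fin (k + 1) → ℤ) (fun _ _ => M)).prod
    (Set.finite_univ)).subset ?_
  rintro ⟨v, σ⟩ h
  refine ⟨⟨h.nonneg, fun t j => ?_⟩, trivial⟩
  rw [← h.sum_eq t]
  exact Finset.single_le_sum (f := v t) (fun i _ => h.nonneg t i) (Finset.mem_univ j)

theorem Set.Finite.even_ncard_of_involution {α : Type*} {s : Set α} (hs : s.Finite)
    (f : α → α) (hmem : ∀ a ∈ s, f a ∈ s) (hinv : ∀ a ∈ s, f (f a) = a)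
    (hne : ∀ a ∈ s, f a ≠ a) : Even s.ncard := by
  classical
  rw [Set.ncard_eq_toFinset_card s hs, ← ZMod.natCast_eq_zero_iff_even]
  have := Finset.sum_involution (s := hs.toFinset) (f := fun _ => (1 : ZMod 2))
    (fun a _ => f a) (fun _ _ => by decide) (fun a ha _ => hne a (by simpa using ha))
    (fun a ha => by simpa using hmem a (by simpa using ha))
    (fun a ha => hinv a (by simpa using ha))
  simpa using this

/-- The fully labelled cells, each listed once: its last step is `transfer 0`. -/
def fullCells {k : ℕ} (M : ℤ) (L : (Fin (k + 1) → ℤ) → Fin (k + 1)) :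
    Set ((Fin (k + 1) → Fin (k + 1) → ℤ) × (Fin (k + 1) → Fin (k + 1))) :=
  {c | IsCell M c.1 c.2 ∧ Function.Injective (fun t => L (c.1 t)) ∧ c.2 (Fin.last k) = 0}

/-- The cells whose vertices other than the vertex `0` carry all labels but the last one. -/
def doors {k : ℕ} (M : ℤ) (L : (Fin (k + 1) → ℤ) → Fin (k + 1)) :
    Set ((Fin (k + 1) → Fin (k + 1) → ℤ) × (Fin (k + 1) → Fin (k + 1))) :=
  {c | IsCell M c.1 c.2 ∧ Set.InjOn (fun t => L (c.1 t)) {0}ᶜ ∧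
    ∀ t ≠ 0, L (c.1 t) ≠ Fin.last k}

theorem finite_doors {k : ℕ} (M : ℤ) (L : (Fin (k + 1) → ℤ) → Fin (k + 1)) :
    (doors M L).Finite :=
  (finite_setOf_isCell k M).subset fun _ h => h.1

theorem exists_eq_label_zero {k : ℕ} {f : Fin (k + 1) → Fin (k + 1)}
    (h0 : f 0 ≠ Fin.last k) (h : ∀ t ≠ 0, f t ≠ Fin.last k) (hf : Set.InjOn f {0}ᶜ) :
    ∃ s ≠ 0, f s = f 0 := by
  by_contra! hc
  have hinj : Function.Injective f := by
    intro a b hab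
    by_cases ha : a = 0 <;> by_cases hb : b = 0
    · rw [ha, hb]
    · subst ha; exact absurd hab.symm (hc b hb)
    · subst hb; exact absurd hab (hc a ha)
    · exact hf ha hb hab
  obtain ⟨t, ht⟩ := (Finite.surjective_of_injective hinj) (Fin.last k)
  by_cases ht0 : t = 0
  · exact h0 (ht0 ▸ ht)
  · exact h t ht0 ht

theorem even_ncard_doors_label_ne_last {k : ℕ} (M : ℤ)
    (L : (Fin (k + 1) → ℤ) → Fin (k + 1)) :
    Even (doors M L \ {c | L (c.1 0) = Fin.last k}).ncard := by
  have key : ∀ c : (Fin (k + 1) → Fin (k + 1) → ℤ) × (Fin (k + 1) → Fin (k + 1)),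
      ∃ s, c ∈ doors M L \ {c | L (c.1 0) = Fin.last k} → s ≠ 0 ∧ L (c.1 s) = L (c.1 0) := by
    intro c
    by_cases hc : c ∈ doors M L \ {c | L (c.1 0) = Fin.last k}
    · obtain ⟨s, hs⟩ := exists_eq_label_zero (f := fun t => L (c.1 t)) hc.2 hc.1.2.2 hc.1.2.1
      exact ⟨s, fun _ => hs⟩
    · exact ⟨0, fun h => absurd h hc⟩
  choose s hs using key
  have hmem : ∀ c ∈ doors M L \ {c | L (c.1 0) = Fin.last k},
      ((fun t => c.1 (t + s c), fun t => c.2 (t + s c)) :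
        (Fin (k + 1) → Fin (k + 1) → ℤ) × (Fin (k + 1) → Fin (k + 1))) ∈
        doors M L \ {c | L (c.1 0) = Fin.last k} := by
    rintro c hc
    obtain ⟨hs0, hsL⟩ := hs c hc
    obtain ⟨⟨hcell, hinj, hlast⟩, h0⟩ := hc
    refine ⟨⟨hcell.rotate _, ?_, ?_⟩, ?_⟩
    · intro a ha b hb hab
      simp only [Set.mem_compl_iff, Set.mem_singleton_iff] at ha hb hab
      have ha' : a + s c ≠ s c := by simpa using ha
      have hb' : b + s c ≠ s c := by simpa using hb
      by_cases ha0 : a + s c = 0 <;> by_cases hb0 : b + s c = 0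
      · exact add_right_cancel (ha0.trans hb0.symm)
      · rw [ha0, ← hsL] at hab
        exact absurd (hinj hs0 hb0 hab).symm hb'
      · rw [hb0, ← hsL] at hab
        exact absurd (hinj ha0 hs0 hab) ha'
      · exact add_right_cancel (hinj ha0 hb0 hab)
    · intro t ht
      by_cases ht0 : t + s c = 0
      · simpa [ht0] using h0
      · exact hlast _ ht0
    · simpa [hsL] using h0
  refine ((finite_doors M L).subset Set.sdiff_subset).even_ncard_of_involution
    (fun c => (fun t => c.1 (t + s c), fun t => c.2 (t + s c))) hmem ?_ ?_
  · intro c hc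
    obtain ⟨hs0, hsL⟩ := hs c hc
    obtain ⟨hs0', hsL'⟩ := hs _ (hmem c hc)
    set c' : (Fin (k + 1) → Fin (k + 1) → ℤ) × (Fin (k + 1) → Fin (k + 1)) :=
      (fun t => c.1 (t + s c), fun t => c.2 (t + s c)) with hc'
    have hsum : s c' = - s c := by
      refine (hmem c hc).1.2.1 hs0' (by simpa using hs0) ?_
      change L (c'.1 (s c')) = L (c'.1 (- s c))
      rw [hsL']
      simp [hc', hsL]
    change ((fun t => c.1 (t + s c' + s c), fun t => c.2 (t + s c' + s c)) :
        (Fin (k + 1) → Fin (k + 1) → ℤ) × (Fin (k + 1) → Fin (k + 1))) = c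
    simp [hsum]
  · intro c hc h
    obtain ⟨hs0, -⟩ := hs c hc
    have h2 := congrFun (congrArg Prod.snd h) 0
    have := hc.1.1.injective h2
    exact hs0 (by simpa using this)

theorem ncard_doors_label_eq_last {k : ℕ} (M : ℤ)
    (L : (Fin (k + 1) → ℤ) → Fin (k + 1)) :
    (doors M L ∩ {c | L (c.1 0) = Fin.last k}).ncard = (fullCells M L).ncard := by
  have hinj : ∀ c ∈ doors M L ∩ {c | L (c.1 0) = Fin.last k},
      Function.Injective (fun t => L (c.1 t)) := by
    rintro c ⟨⟨-, h1, h2⟩, h3⟩ a b hab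
    simp only [Set.mem_ofPred_eq] at h3 hab
    by_cases ha : a = 0 <;> by_cases hb : b = 0
    · rw [ha, hb]
    · subst ha; exact absurd (hab.symm.trans h3) (h2 b hb)
    · subst hb; exact absurd (hab.trans h3) (h2 a ha)
    · exact h1 ha hb hab
  have key : ∀ c : (Fin (k + 1) → Fin (k + 1) → ℤ) × (Fin (k + 1) → Fin (k + 1)),
      ∃ s, IsCell M c.1 c.2 → c.2 (Fin.last k + s) = 0 := by
    intro c
    by_cases hc : IsCell M c.1 c.2
    · obtain ⟨t, ht⟩ := Finite.surjective_of_injective hc.injective 0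
      exact ⟨t - Fin.last k, fun _ => by simpa using ht⟩
    · exact ⟨0, fun h => absurd h hc⟩
  choose s hs using key
  refine Set.ncard_congr (fun c _ => (fun t => c.1 (t + s c), fun t => c.2 (t + s c))) ?_ ?_ ?_
  · intro c hc
    exact ⟨hc.1.1.rotate _, fun a b hab => add_right_cancel (hinj c hc hab), hs c hc.1.1⟩
  · intro c c' hc hc' h
    have h1 : ∀ t, c.1 (t + s c) = c'.1 (t + s c') := fun t => congrFun (congrArg Prod.fst h) t
    have h2 : ∀ t, c.2 (t + s c) = c'.2 (t + s c') := fun t => congrFun (congrArg Prod.snd h) t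
    have h0 : s c = s c' := by
      have h3 := h1 (- s c)
      rw [neg_add_cancel] at h3
      have h4 : L (c'.1 (-s c + s c')) = L (c'.1 0) := by
        rw [← h3]; exact hc.2.trans hc'.2.symm
      have := hinj c' hc' h4
      rwa [neg_add_eq_zero] at this
    ext1
    · ext1 t
      simpa [h0] using h1 (t - s c)
    · ext1 t
      simpa [h0] using h2 (t - s c)
  · rintro ⟨v, σ⟩ ⟨hcell, hI, hlast⟩
    obtain ⟨r, hr⟩ := Finite.surjective_of_injective hI (Fin.last k)
    have hr' : L (v r) = Fin.last k := hr
    have hcell' := hcell.rotate r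
    have hsr : s (fun t => v (t + r), fun t => σ (t + r)) = - r := by
      have h1 := hs (fun t => v (t + r), fun t => σ (t + r)) hcell'
      have h2 := hcell.injective (h1.trans hlast.symm)
      rw [add_assoc, add_eq_left] at h2
      exact eq_neg_of_add_eq_zero_left h2
    refine ⟨(fun t => v (t + r), fun t => σ (t + r)), ⟨⟨hcell', ?_, ?_⟩, ?_⟩, ?_⟩
    · intro a _ b _ hab
      exact add_right_cancel (hI hab)
    · intro t ht h
      have := hI (h.trans hr'.symm)
      exact ht (by simpa using this)
    · simpa using hr'
    · simp [hsr]

theorem even_ncard_doors_nonneg {k : ℕ} (M : ℤ)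
    (L : (Fin (k + 2) → ℤ) → Fin (k + 2)) :
    Even (doors M L ∩ {c | 0 ≤ c.1 (Fin.last (k + 1)) + transfer (c.2 0)}).ncard := by
  have hl : Fin.last (k + 1) ≠ 0 := by simp
  have hl1 : Fin.last (k + 1) + 1 = 0 := by simp
  refine ((finite_doors M L).subset Set.inter_subset_left).even_ncard_of_involution
    (fun c => (Function.update c.1 0 (c.1 (Fin.last (k + 1)) + transfer (c.2 0)),
      c.2 ∘ Equiv.swap 0 (Fin.last (k + 1)))) ?_ ?_ ?_
  · rintro ⟨v, σ⟩ ⟨⟨hcell, hinj, hlast⟩, h0⟩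
    simp only [Set.mem_ofPred_eq] at hcell hinj hlast h0
    have hv0 : v 0 = v (Fin.last (k + 1)) + transfer (σ (Fin.last (k + 1))) := by
      rw [← hcell.step, hl1]
    refine ⟨⟨⟨hcell.injective.comp (Equiv.injective _), ?_, ?_, ?_⟩, ?_, ?_⟩, ?_⟩
    · intro t
      by_cases ht : t = 0
      · subst ht; simpa using h0
      · simpa [ht] using hcell.nonneg t
    · intro t
      by_cases ht : t = 0
      · subst ht
        simp [Finset.sum_add_distrib, hcell.sum_eq, sum_transfer]
      · simpa [ht] using hcell.sum_eq t
    · intro t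
      by_cases ht : t = 0
      · subst ht
        have := hcell.step 0
        simp only [zero_add] at this
        simp only [zero_add, ne_eq, one_ne_zero, not_false_eq_true, Function.update_of_ne,
          Function.update_self, Function.comp_apply, Equiv.swap_apply_left]
        rw [this, hv0]
        abel
      · by_cases htl : t = Fin.last (k + 1)
        · subst htl
          simp [hl1, hl]
        · have ht1 : t + 1 ≠ 0 := fun h => htl (by
            rw [← hl1] at h; exact add_right_cancel h)
          simp only [ne_eq, ht, ht1, not_false_eq_true, Function.update_of_ne,
            Function.comp_apply, Equiv.swap_apply_of_ne_of_ne ht htl]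
          exact hcell.step t
    · intro a ha b hb hab
      have ha' : a ≠ 0 := ha
      have hb' : b ≠ 0 := hb
      simp only [ne_eq, ha', hb', not_false_eq_true, Function.update_of_ne] at hab
      exact hinj ha hb hab
    · intro t ht
      simpa [ht] using hlast t ht
    · simp only [Set.mem_ofPred_eq, ne_eq, hl, not_false_eq_true, Function.update_of_ne,
        Function.comp_apply, Equiv.swap_apply_left]
      rw [← hv0]
      exact hcell.nonneg 0
  · rintro ⟨v, σ⟩ ⟨⟨hcell, -, -⟩, -⟩
    have hv0 : v 0 = v (Fin.last (k + 1)) + transfer (σ (Fin.last (k + 1))) := by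
      rw [← hcell.step, hl1]
    ext1
    · ext1 t
      by_cases ht : t = 0
      · subst ht
        simp [hl, hv0]
      · simp [ht]
    · ext1 t
      simp
  · rintro ⟨v, σ⟩ ⟨⟨hcell, -, -⟩, -⟩ h
    have := congrFun (congrArg Prod.snd h) 0
    simp only [Function.comp_apply, Equiv.swap_apply_left] at this
    exact hl (hcell.injective this)

theorem Fin.castSucc_add_one_eq_castSucc_iff {k : ℕ} {a j : Fin (k + 1)} (ha : a ≠ 0) :
    j.castSucc + 1 = a.castSucc ↔ j + 1 = a := by
  simp only [Fin.ext_iff, Fin.val_add_one, Fin.val_castSucc, Fin.val_last, Fin.val_zero, ne_eq]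
    at *
  split_ifs <;> omega

theorem transfer_castSucc_castSucc {k : ℕ} {a : Fin (k + 1)} (ha : a ≠ 0) (j : Fin (k + 1)) :
    transfer a.castSucc j.castSucc = transfer a j := by
  simp only [transfer, Fin.castSucc_add_one_eq_castSucc_iff ha, Fin.castSucc_inj]

theorem transfer_castSucc_last {k : ℕ} {a : Fin (k + 1)} (ha : a ≠ 0) :
    transfer a.castSucc (Fin.last (k + 1)) = 0 := by
  have h1 : (0 : Fin (k + 2)) ≠ a.castSucc := by
    rw [← Fin.castSucc_zero, ne_eq, Fin.castSucc_inj]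
    exact ha.symm
  have h2 : Fin.last (k + 1) ≠ a.castSucc := (Fin.castSucc_lt_last a).ne'
  simp [transfer, h1, h2]

theorem transfer_zero_last (k : ℕ) :
    transfer (0 : Fin (k + 2)) (Fin.last (k + 1)) = 1 := by
  simp [transfer]

theorem transfer_last_last (k : ℕ) :
    transfer (Fin.last (k + 1)) (Fin.last (k + 1)) = -1 := by
  have : (0 : Fin (k + 2)) ≠ Fin.last (k + 1) := by simp [Fin.ext_iff]
  simp [transfer, this]

theorem Fin.castSucc_add_one_ne_zero {k : ℕ} (j : Fin (k + 1)) : j.castSucc + 1 ≠ 0 := by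
  rw [Fin.coeSucc_eq_succ]
  exact Fin.succ_ne_zero j

theorem transfer_zero_castSucc {k : ℕ} (j : Fin (k + 1)) :
    transfer (0 : Fin (k + 2)) j.castSucc = if j = 0 then -1 else 0 := by
  simp only [transfer, Fin.castSucc_add_one_ne_zero, Fin.castSucc_eq_zero_iff, if_false]
  split_ifs <;> rfl

theorem transfer_last_castSucc {k : ℕ} (j : Fin (k + 1)) :
    transfer (Fin.last (k + 1)) j.castSucc = if j = Fin.last k then 1 else 0 := by
  have h : j.castSucc ≠ Fin.last (k + 1) := (Fin.castSucc_lt_last j).ne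
  rw [transfer, Fin.coeSucc_eq_succ, if_neg h, ← Fin.succ_last, sub_zero]
  simp only [Fin.succ_inj]

theorem transfer_zero_add_transfer_last_castSucc {k : ℕ} (j : Fin (k + 1)) :
    transfer (0 : Fin (k + 2)) j.castSucc + transfer (Fin.last (k + 1)) j.castSucc =
      transfer 0 j := by
  have h : j + 1 = 0 ↔ j = Fin.last k := by
    rw [← Fin.last_add_one k, add_left_inj]
  rw [transfer_zero_castSucc, transfer_last_castSucc]
  simp only [transfer, h]
  split_ifs <;> rfl

/-- A labelling is Sperner if the label of a point is a coordinate at which it is positive. -/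
def IsSperner {k : ℕ} (M : ℤ) (L : (Fin (k + 1) → ℤ) → Fin (k + 1)) : Prop :=
  ∀ l : Fin (k + 1) → ℤ, 0 ≤ l → ∑ j, l j = M → 0 < l (L l)

/-- A door that cannot be crossed lies in the face where the last coordinate vanishes. -/
theorem IsCell.boundary_door {k : ℕ} {M : ℤ} {L : (Fin (k + 2) → ℤ) → Fin (k + 2)}
    (hL : IsSperner M L) {v : Fin (k + 2) → Fin (k + 2) → ℤ} {σ : Fin (k + 2) → Fin (k + 2)}
    (h : (v, σ) ∈ doors M L) (hv : ¬ 0 ≤ v (Fin.last (k + 1)) + transfer (σ 0)) :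
    σ 0 = Fin.last (k + 1) ∧ σ (Fin.last (k + 1)) = 0 ∧ ∀ t ≠ 0, v t (Fin.last (k + 1)) = 0 := by
  obtain ⟨hcell, hinj, hlast⟩ := h
  simp only at hcell hinj hlast
  have hl1 : Fin.last (k + 1) + 1 = 0 := by simp
  have hv0 := hcell.step (Fin.last (k + 1))
  rw [hl1] at hv0
  have hv1 := hcell.step 0
  rw [zero_add] at hv1
  have hne : σ 0 ≠ σ (Fin.last (k + 1)) := fun h => by
    have := hcell.injective h
    simp [Fin.ext_iff] at this
  -- the coordinate that becomes negative is `σ 0`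
  have hneg : v (Fin.last (k + 1)) (σ 0) = 0 ∧ σ 0 + 1 = σ (Fin.last (k + 1)) := by
    rw [Pi.le_def] at hv
    push Not at hv
    obtain ⟨j, hj⟩ := hv
    have hj0 := hcell.nonneg (Fin.last (k + 1)) j
    have hj1 := congrFun hv0 j
    have hj2 := congrFun hv1 j
    have hj3 := hcell.nonneg 1 j
    simp only [Pi.add_apply, Pi.zero_apply, transfer] at *
    have hjs : j = σ 0 := by
      by_contra hc
      simp only [hc, if_false] at hj
      split_ifs at hj <;> omega
    subst hjs
    have h10 : σ 0 + 1 ≠ σ 0 := by simp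
    simp only [h10, hne, if_true, if_false] at *
    split_ifs at * with h5
    · exact ⟨by omega, h5⟩
    · omega
  obtain ⟨hz, hs⟩ := hneg
  have hzero : ∀ t : Fin (k + 2), t ≠ 0 → v t (σ 0) = 0 := by
    intro t
    induction t using Fin.induction with
    | zero => intro h; exact absurd rfl h
    | succ i ih =>
      intro _
      have h3 := congrFun (hcell.step i.castSucc) (σ 0)
      rw [Fin.coeSucc_eq_succ] at h3
      simp only [Pi.add_apply, transfer] at h3
      by_cases hi : i.castSucc = 0
      · have h4 := congrFun hv0 (σ 0)
        have h10 : σ 0 + 1 ≠ σ 0 := by simp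
        simp only [Pi.add_apply, transfer, hs, hne, hz, if_true, if_false] at h4
        rw [hi] at h3
        simp only [h10, if_true, if_false] at h3
        omega
      · have h5 : σ 0 + 1 ≠ σ i.castSucc := by
          rw [hs]
          intro h
          exact (Fin.castSucc_lt_last i).ne (hcell.injective h).symm
        have h6 : σ 0 ≠ σ i.castSucc := fun h => hi (hcell.injective h).symm
        simp only [h5, h6, if_false, ih hi] at h3
        omega
  have h0 : σ 0 = Fin.last (k + 1) := by
    by_contra hc
    obtain ⟨s, hs0, hs1⟩ := exists_eq_label_zero
      (f := fun t => if t = 0 then σ 0 else L (v t)) (by simpa using hc)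
      (fun t ht => by simpa [ht] using hlast t ht)
      (fun a ha b hb hab => hinj ha hb (by
        have ha' : a ≠ 0 := ha
        have hb' : b ≠ 0 := hb
        simpa [ha', hb'] using hab))
    simp only [hs0, if_true, if_false] at hs1
    have h1 := hL (v s) (hcell.nonneg s) (hcell.sum_eq s)
    rw [hs1, hzero s hs0] at h1
    exact lt_irrefl _ h1
  rw [h0] at hs hzero
  exact ⟨h0, by rw [← hs, hl1], hzero⟩

theorem IsSperner.sum_pos {k : ℕ} {M : ℤ} {L : (Fin (k + 1) → ℤ) → Fin (k + 1)}
    (hL : IsSperner M L) {l : Fin (k + 1) → ℤ} (h0 : 0 ≤ l) (hl : ∑ j, l j = M) : 0 < M :=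
  (hL l h0 hl).trans_le (hl ▸ Finset.single_le_sum (f := l) (fun i _ => h0 i) (Finset.mem_univ _))

theorem ncard_boundary_doors {k : ℕ} {M : ℤ} {L : (Fin (k + 2) → ℤ) → Fin (k + 2)}
    (hL : IsSperner M L) {L' : (Fin (k + 1) → ℤ) → Fin (k + 1)}
    (hLL' : ∀ l, 0 ≤ l → ∑ j, l j = M →
      (L' l).castSucc = L (Fin.snoc (α := fun _ => ℤ) l 0)) :
    (fullCells M L').ncard =
      (doors M L \ {c | 0 ≤ c.1 (Fin.last (k + 1)) + transfer (c.2 0)}).ncard := by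
  refine Set.ncard_congr (fun c _ =>
    (Fin.cons (Fin.snoc (α := fun _ => ℤ) (c.1 (Fin.last k)) 0 + transfer 0)
      (fun t => Fin.snoc (α := fun _ => ℤ) (c.1 t) 0),
     Fin.cons (Fin.last (k + 1)) (fun t => (c.2 t).castSucc))) ?_ ?_ ?_
  · rintro ⟨v, σ⟩ ⟨hcell, hI, hlast⟩
    simp only at hcell hI hlast
    have hlab : ∀ t, L (Fin.snoc (α := fun _ => ℤ) (v t) 0) = (L' (v t)).castSucc :=
      fun t => (hLL' _ (hcell.nonneg t) (hcell.sum_eq t)).symm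
    have hσ : ∀ t, t ≠ Fin.last k → σ t ≠ 0 := fun t ht h =>
      ht (hcell.injective (h.trans hlast.symm))
    have hstep := hcell.step (Fin.last k)
    simp only [Fin.last_add_one, hlast] at hstep
    refine ⟨⟨⟨?_, ?_, ?_, ?_⟩, ?_, ?_⟩, ?_⟩
    · rw [Fin.cons_injective_iff]
      refine ⟨?_, fun a b h => hcell.injective (Fin.castSucc_injective _ h)⟩
      rintro ⟨t, ht⟩
      exact (Fin.castSucc_lt_last _).ne ht
    · intro t
      cases t using Fin.cases with
      | zero =>
        intro j
        cases j using Fin.lastCases with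
        | last => simp [transfer_zero_last]
        | cast j =>
          have h1 := hcell.nonneg (Fin.last k) j
          have h2 := hcell.nonneg 0 j
          have h3 := congrFun hstep j
          simp only [Pi.add_apply, Pi.zero_apply, Fin.cons_zero, Fin.snoc_castSucc] at *
          rw [← transfer_zero_add_transfer_last_castSucc] at h3
          by_cases hk : k = 0
          · subst hk
            have h4 := hL.sum_pos (l := Fin.snoc (α := fun _ => ℤ) (v 0) 0) ?_ ?_
            · have h5 := hcell.sum_eq (Fin.last 0)
              rw [Fin.sum_univ_one] at h5
              rw [transfer_zero_castSucc]
              have : j = 0 := Fin.fin_one_eq_zero j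
              subst this
              simp only [if_true]
              omega
            · intro i
              cases i using Fin.lastCases with
              | last => rw [Fin.snoc_last]; rfl
              | cast i => simpa using hcell.nonneg 0 i
            · rw [Fin.sum_univ_castSucc]
              simpa only [Fin.snoc_castSucc, Fin.snoc_last, add_zero] using hcell.sum_eq 0
          · have h5 : transfer (Fin.last (k + 1)) j.castSucc ≤ 0 ∨
                transfer (0 : Fin (k + 2)) j.castSucc = 0 := by
              rw [transfer_zero_castSucc]
              by_cases hj : j = 0
              · left
                have : (0 : Fin (k + 1)) ≠ Fin.last k := by
                  simpa [Fin.ext_iff, eq_comm] using hk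
                rw [transfer_last_castSucc, hj, if_neg this]
              · right; simp [hj]
            omega
      | succ t =>
        intro j
        cases j using Fin.lastCases with
        | last => simp
        | cast j => simpa using hcell.nonneg t j
    · intro t
      cases t using Fin.cases with
      | zero =>
        simp only [Fin.cons_zero, Pi.add_apply, Finset.sum_add_distrib, sum_transfer]
        simpa [Fin.sum_univ_castSucc] using hcell.sum_eq (Fin.last k)
      | succ t =>
        simpa [Fin.sum_univ_castSucc] using hcell.sum_eq t
    · intro t
      cases t using Fin.cases with
      | zero =>
        have h1 : (0 : Fin (k + 2)) + 1 = Fin.succ 0 := by simp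
        rw [h1]
        simp only [Fin.cons_succ, Fin.cons_zero]
        ext j
        cases j using Fin.lastCases with
        | last => simp [transfer_zero_last, transfer_last_last]
        | cast j =>
          have h3 := congrFun hstep j
          rw [Pi.add_apply, ← transfer_zero_add_transfer_last_castSucc] at h3
          simp [h3, add_assoc]
      | succ t =>
        cases t using Fin.lastCases with
        | last => simp [hlast]
        | cast t =>
          have h1 : t.castSucc.succ + 1 = t.succ.succ := by
            rw [← Fin.castSucc_succ, Fin.coeSucc_eq_succ]
          have hne := hσ t.castSucc (Fin.castSucc_lt_last t).ne
          rw [h1]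
          simp only [Fin.cons_succ]
          have h3 := hcell.step t.castSucc
          rw [Fin.coeSucc_eq_succ] at h3
          ext j
          cases j using Fin.lastCases with
          | last => simp [transfer_castSucc_last hne]
          | cast j => simp [h3, transfer_castSucc_castSucc hne]
    · intro a ha b hb hab
      cases a using Fin.cases with
      | zero => exact absurd rfl ha
      | succ a =>
        cases b using Fin.cases with
        | zero => exact absurd rfl hb
        | succ b =>
          simp only [Fin.cons_succ, hlab] at hab
          rw [hI (Fin.castSucc_injective _ hab)]
    · intro t ht
      cases t using Fin.cases with
      | zero => exact absurd rfl ht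
      | succ t =>
        simp only [Fin.cons_succ, hlab]
        exact (Fin.castSucc_lt_last _).ne
    · intro h
      have h1 := h (Fin.last (k + 1))
      rw [← Fin.succ_last] at h1
      simp only [Fin.cons_succ, Fin.cons_zero, Pi.zero_apply, Pi.add_apply] at h1
      rw [Fin.succ_last, transfer_last_last, Fin.snoc_last] at h1
      omega
  · rintro ⟨v, σ⟩ ⟨v', σ'⟩ - - h
    simp only [Prod.mk.injEq] at h
    have h1 : ∀ t, v t = v' t := fun t => by
      have := congrFun h.1 t.succ
      simp only [Fin.cons_succ] at this
      exact (Fin.snoc_inj.mp this).1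
    have h2 : ∀ t, σ t = σ' t := fun t => by
      simpa using congrFun h.2 t.succ
    rw [funext h1, funext h2]
  · rintro ⟨v, σ⟩ ⟨hd, hnn⟩
    obtain ⟨hσ0, hσl, hz⟩ := IsCell.boundary_door hL hd hnn
    obtain ⟨hcell, hinj, hlast⟩ := hd
    simp only at hcell hinj hlast
    have hne : ∀ t : Fin (k + 1), σ t.succ ≠ Fin.last (k + 1) := fun t h =>
      Fin.succ_ne_zero t (hcell.injective (h.trans hσ0.symm))
    choose σ' hσ' using fun t => Fin.exists_castSucc_eq.mpr (hne t)
    have hsn : ∀ t : Fin (k + 1), Fin.snoc (α := fun _ => ℤ)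
        (fun j : Fin (k + 1) => v t.succ j.castSucc) 0 = v t.succ := by
      intro t
      ext j
      cases j using Fin.lastCases with
      | last => simp [hz t.succ (Fin.succ_ne_zero t)]
      | cast j => simp
    have hnn' : ∀ t : Fin (k + 1), 0 ≤ fun j : Fin (k + 1) => v t.succ j.castSucc :=
      fun t j => hcell.nonneg t.succ j.castSucc
    have hsum : ∀ t : Fin (k + 1), ∑ j : Fin (k + 1), v t.succ j.castSucc = M := by
      intro t
      have := hcell.sum_eq t.succ
      rwa [Fin.sum_univ_castSucc, hz t.succ (Fin.succ_ne_zero t), add_zero] at this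
    have hlast' : σ' (Fin.last k) = 0 := by
      apply Fin.castSucc_injective
      rw [hσ', Fin.succ_last, hσl, Fin.castSucc_zero]
    have hinj' : Function.Injective σ' := by
      intro a b h
      have := congrArg Fin.castSucc h
      rw [hσ', hσ'] at this
      exact Fin.succ_injective _ (hcell.injective this)
    have hv0 := hcell.step (Fin.last (k + 1))
    rw [Fin.last_add_one, hσl] at hv0
    have hv1 := hcell.step 0
    rw [zero_add, hσ0, hv0] at hv1
    refine ⟨(fun t j => v t.succ j.castSucc, σ'), ⟨⟨hinj', hnn', hsum, ?_⟩, ?_, hlast'⟩, ?_⟩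
    · intro t
      ext j
      cases t using Fin.lastCases with
      | last =>
        have := congrFun hv1 j.castSucc
        simp only [Pi.add_apply, add_assoc, transfer_zero_add_transfer_last_castSucc] at this
        simpa [hlast'] using this
      | cast t =>
        have hne0 : σ' t.castSucc ≠ 0 := fun h =>
          (Fin.castSucc_lt_last t).ne (hinj' (h.trans hlast'.symm))
        have h3 := congrFun (hcell.step t.succ.castSucc) j.castSucc
        rw [Fin.coeSucc_eq_succ, Pi.add_apply, Fin.castSucc_succ, ← hσ',
          transfer_castSucc_castSucc hne0] at h3
        simpa [Fin.coeSucc_eq_succ] using h3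
    · intro a b hab
      have := congrArg Fin.castSucc hab
      simp only at this
      rw [hLL' _ (hnn' a) (hsum a), hLL' _ (hnn' b) (hsum b), hsn, hsn] at this
      exact Fin.succ_injective _ (hinj (Fin.succ_ne_zero a) (Fin.succ_ne_zero b) this)
    · ext1
      · ext1 t
        cases t using Fin.cases with
        | zero =>
          simp only [Fin.cons_zero]
          rw [hsn, Fin.succ_last, hv0]
        | succ t => simp only [Fin.cons_succ, hsn]
      · ext1 t
        cases t using Fin.cases with
        | zero => simp only [Fin.cons_zero, hσ0]
        | succ t => simp only [Fin.cons_succ, hσ']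

/-- Sperner's lemma: the number of fully labelled cells is odd. -/
theorem IsSperner.odd_ncard_fullCells {k : ℕ} {M : ℤ} (hM : 0 ≤ M)
    {L : (Fin (k + 1) → ℤ) → Fin (k + 1)} (hL : IsSperner M L) :
    Odd (fullCells M L).ncard := by
  induction k with
  | zero =>
    have : fullCells M L = {(fun _ _ => M, fun _ => 0)} := by
      ext ⟨v, σ⟩
      constructor
      · rintro ⟨hcell, -, -⟩
        have h1 : v = fun _ _ => M := by
          ext t j
          have := hcell.sum_eq t
          rw [Fin.sum_univ_one] at this
          rwa [Fin.fin_one_eq_zero j]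
        have h2 : σ = fun _ => 0 := funext fun t => Fin.fin_one_eq_zero _
        rw [h1, h2]
        rfl
      · rintro h
        obtain ⟨rfl, rfl⟩ := Prod.mk.inj h
        refine ⟨⟨fun a b _ => (Fin.fin_one_eq_zero a).trans (Fin.fin_one_eq_zero b).symm,
            fun _ _ => hM, fun _ => by simp, fun t => ?_⟩,
          fun a b _ => (Fin.fin_one_eq_zero a).trans (Fin.fin_one_eq_zero b).symm, rfl⟩
        ext j
        have : ∀ a b : Fin 1, (a = b) = True := fun a b => by simp [Fin.fin_one_eq_zero]
        simp [transfer, this]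
    simp [this]
  | succ k ih =>
    have key : ∀ l : Fin (k + 1) → ℤ, ∃ i : Fin (k + 1), 0 ≤ l → ∑ j, l j = M →
        i.castSucc = L (Fin.snoc (α := fun _ => ℤ) l 0) := by
      intro l
      by_cases h : 0 ≤ l ∧ ∑ j, l j = M
      · have hpos := hL (Fin.snoc (α := fun _ => ℤ) l 0) (fun j => by
          cases j using Fin.lastCases with
          | last => simp
          | cast j => simpa using h.1 j) (by simpa [Fin.sum_univ_castSucc] using h.2)
        have hne : L (Fin.snoc (α := fun _ => ℤ) l 0) ≠ Fin.last (k + 1) := by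
          intro h
          rw [h] at hpos
          simp at hpos
        obtain ⟨i, hi⟩ := Fin.exists_castSucc_eq.mpr hne
        exact ⟨i, fun _ _ => hi⟩
      · exact ⟨0, fun h1 h2 => absurd ⟨h1, h2⟩ h⟩
    choose L' hL' using key
    have hSp : IsSperner M L' := by
      intro l h0 hs
      have hpos := hL (Fin.snoc (α := fun _ => ℤ) l 0) (fun j => by
        cases j using Fin.lastCases with
        | last => simp
        | cast j => simpa using h0 j) (by simpa [Fin.sum_univ_castSucc] using hs)
      rw [← hL' l h0 hs] at hpos
      simpa using hpos
    have h1 := even_ncard_doors_label_ne_last M L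
    have h2 := even_ncard_doors_nonneg M L
    have h3 := Set.ncard_inter_add_ncard_sdiff_eq_ncard (doors M L)
      {c | L (c.1 0) = Fin.last (k + 1)} (finite_doors M L)
    have h4 := Set.ncard_inter_add_ncard_sdiff_eq_ncard (doors M L)
      {c | 0 ≤ c.1 (Fin.last (k + 1)) + transfer (c.2 0)} (finite_doors M L)
    rw [ncard_doors_label_eq_last] at h3
    rw [← ncard_boundary_doors hL hL'] at h4
    have h5 := ih hSp
    rw [← Nat.not_even_iff_odd] at *
    intro h6
    have h7 : Even (doors M L).ncard := h3 ▸ h6.add h1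
    rw [← h4, Nat.even_add] at h7
    exact h5 (h7.mp h2)

/-- The sum of the first `j` coordinates of `l`: the position of the `j`-th knife when
`l` is the vector of lengths of the pieces. -/
def knife {k : ℕ} (l : Fin (k + 1) → ℤ) (j : ℕ) : ℤ :=
  ∑ i : Fin (k + 1), if (i : ℕ) < j then l i else 0

theorem knife_zero {k : ℕ} (l : Fin (k + 1) → ℤ) : knife l 0 = 0 := by
  simp [knife]

theorem knife_add_one_eq_sum {k : ℕ} (l : Fin (k + 1) → ℤ) : knife l (k + 1) = ∑ i, l i := by
  exact Finset.sum_congr rfl fun i _ => if_pos i.is_lt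

theorem knife_succ {k : ℕ} (l : Fin (k + 1) → ℤ) (j : Fin (k + 1)) :
    knife l (j + 1) = knife l j + l j := by
  have h : ∀ i : Fin (k + 1), (if (i : ℕ) < j + 1 then l i else 0) =
      (if (i : ℕ) < j then l i else 0) + if i = j then l i else 0 := by
    intro i
    simp only [Fin.ext_iff]
    split_ifs <;> omega
  simp only [knife, h, Finset.sum_add_distrib, Finset.sum_ite_eq', Finset.mem_univ, if_true]

theorem knife_add {k : ℕ} (l l' : Fin (k + 1) → ℤ) (j : ℕ) :
    knife (l + l') j = knife l j + knife l' j := by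
  simp only [knife, ← Finset.sum_add_distrib]
  refine Finset.sum_congr rfl fun i _ => ?_
  split_ifs <;> simp

theorem knife_monotone {k : ℕ} {l : Fin (k + 1) → ℤ} (h : 0 ≤ l) : Monotone (knife l) := by
  intro a b hab
  refine Finset.sum_le_sum fun i _ => ?_
  have := h i
  simp only [Pi.zero_apply] at this
  split_ifs <;> omega

theorem knife_transfer_nonneg {k : ℕ} {a : Fin (k + 1)} (ha : a ≠ 0) {j : ℕ} (hj : j ≤ k + 1) :
    0 ≤ knife (transfer a) j := by
  suffices h : knife (transfer a) j = if j = (a : ℕ) then 1 else 0 by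
    rw [h]; split_ifs <;> simp
  have ha' : (a : ℕ) ≠ 0 := fun h => ha (Fin.ext h)
  induction j with
  | zero => rw [knife_zero, if_neg ha'.symm]
  | succ j ih =>
    have h := knife_succ (transfer a) ⟨j, hj⟩
    have h1 : (⟨j, hj⟩ : Fin (k + 1)) + 1 = a ↔ j + 1 = a := by
      have := a.is_lt
      rw [Fin.ext_iff, Fin.val_add_one]
      simp only [Fin.ext_iff, Fin.val_last]
      split_ifs <;> omega
    have h2 : (⟨j, hj⟩ : Fin (k + 1)) = a ↔ j = a := Fin.ext_iff
    have h3 : transfer a ⟨j, hj⟩ = (if j + 1 = a then 1 else 0) - if j = a then 1 else 0 := by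
      simp only [transfer, h1, h2]
    rw [h3] at h
    refine Eq.trans h ?_
    rw [ih (by omega)]
    ring

theorem neg_one_le_knife_transfer_zero {k : ℕ} {j : ℕ} (hj : j ≤ k + 1) :
    -1 ≤ knife (transfer (0 : Fin (k + 1))) j := by
  suffices h : knife (transfer (0 : Fin (k + 1))) j =
      (if j = k + 1 then 1 else 0) - if j = 0 then 0 else 1 by
    rw [h]; split_ifs <;> simp
  induction j with
  | zero => simp [knife_zero]
  | succ j ih =>
    have h := knife_succ (transfer 0) ⟨j, hj⟩
    have h1 : (⟨j, hj⟩ : Fin (k + 1)) + 1 = 0 ↔ j = k := by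
      rw [← Fin.last_add_one k, add_left_inj, Fin.ext_iff, Fin.val_last]
    have h2 : (⟨j, hj⟩ : Fin (k + 1)) = 0 ↔ j = 0 := Fin.ext_iff
    have h3 : transfer (0 : Fin (k + 1)) ⟨j, hj⟩ =
        (if j = k then 1 else 0) - if j = 0 then 1 else 0 := by
      simp only [transfer, h1, h2]
    rw [h3] at h
    refine Eq.trans h ?_
    rw [ih (by omega)]
    rw [if_neg (Nat.succ_ne_zero j)]
    split_ifs <;> omega

theorem IsCell.knife_bounds {k : ℕ} {M : ℤ} {v : Fin (k + 1) → Fin (k + 1) → ℤ}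
    {σ : Fin (k + 1) → Fin (k + 1)} (h : IsCell M v σ) (hσ : σ (Fin.last k) = 0)
    (t : Fin (k + 1)) {j : ℕ} (hj : j ≤ k + 1) :
    knife (v 0) j ≤ knife (v t) j ∧ knife (v t) j ≤ knife (v 0) j + 1 := by
  have hstep : ∀ t : Fin k, knife (v t.castSucc) j ≤ knife (v t.succ) j := by
    intro t
    have hne : σ t.castSucc ≠ 0 := fun h0 =>
      (Fin.castSucc_lt_last t).ne (h.injective (h0.trans hσ.symm))
    have := knife_transfer_nonneg hne hj
    rw [← Fin.coeSucc_eq_succ, h.step, knife_add]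
    omega
  constructor
  · induction t using Fin.induction with
    | zero => exact le_rfl
    | succ t ih => exact ih.trans (hstep t)
  · induction t using Fin.reverseInduction with
    | last =>
      have h0 := h.step (Fin.last k)
      rw [Fin.last_add_one, hσ] at h0
      have := neg_one_le_knife_transfer_zero hj
      rw [h0, knife_add]
      omega
    | cast t ih => exact (hstep t).trans ih

/-- The agent owning a vertex. -/
def owner {k : ℕ} (l : Fin (k + 1) → ℤ) : ZMod (k + 1) :=
  ∑ i, (l i : ZMod (k + 1)) * ((i : ℕ) : ZMod (k + 1))

theorem owner_transfer {k : ℕ} (a : Fin (k + 1)) : owner (transfer a) = -1 := by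
  obtain ⟨b, rfl⟩ : ∃ b, a = b + 1 := ⟨a - 1, by simp⟩
  have h : (((b + 1 : Fin (k + 1)) : ℕ) : ZMod (k + 1)) = ((b : ℕ) : ZMod (k + 1)) + 1 := by
    rw [Fin.val_add_one]
    split_ifs with hb
    · have := ZMod.natCast_self (k + 1)
      rw [hb, Fin.val_last]
      push_cast at this ⊢
      exact this.symm
    · push_cast; rfl
  simp only [owner, transfer, add_left_inj, Int.cast_sub, Int.cast_ite, Int.cast_one,
    Int.cast_zero, sub_mul, ite_mul, one_mul, zero_mul, Finset.sum_sub_distrib,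
    Finset.sum_ite_eq', Finset.mem_univ, if_true, h]
  ring

theorem owner_add {k : ℕ} (l l' : Fin (k + 1) → ℤ) : owner (l + l') = owner l + owner l' := by
  simp [owner, add_mul, Finset.sum_add_distrib]

theorem IsCell.owner_injective {k : ℕ} {M : ℤ} {v : Fin (k + 1) → Fin (k + 1) → ℤ}
    {σ : Fin (k + 1) → Fin (k + 1)} (h : IsCell M v σ) :
    Function.Injective fun t => owner (v t) := by
  have key : ∀ t : Fin (k + 1), owner (v t) = owner (v 0) - ((t : ℕ) : ZMod (k + 1)) := by
    intro t
    induction t using Fin.induction with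
    | zero => simp
    | succ t ih =>
      rw [← Fin.coeSucc_eq_succ, h.step, owner_add, owner_transfer, ih, Fin.coeSucc_eq_succ,
        Fin.val_succ, Fin.val_castSucc]
      push_cast
      ring
  intro a b hab
  have hab := (key a).symm.trans (hab.trans (key b))
  rw [sub_right_inj] at hab
  rw [ZMod.natCast_eq_natCast_iff', Nat.mod_eq_of_lt a.is_lt, Nat.mod_eq_of_lt b.is_lt] at hab
  exact Fin.ext hab

/-- The items lying between the positions `a` and `b`, where item `i` occupies the segment from
`2 * i` to `2 * i + 2`. -/
def between (m : ℕ) (a b : ℤ) : Finset (Fin m) :=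
  {i | a ≤ 2 * (i : ℤ) ∧ 2 * (i : ℤ) + 2 ≤ b}

theorem mem_between {m : ℕ} {a b : ℤ} {i : Fin m} :
    i ∈ between m a b ↔ a ≤ 2 * (i : ℤ) ∧ 2 * (i : ℤ) + 2 ≤ b := by
  simp [between]

theorem isInterval_between (m : ℕ) (a b : ℤ) : IsInterval (between m a b) := by
  intro x y z hxy hyz hx hz
  rw [mem_between] at *
  rw [Fin.le_def] at hxy hyz
  omega

theorem exists_le_lt_succ {f : ℕ → ℤ} {y : ℤ} {n : ℕ} (h0 : f 0 ≤ y) (hn : y < f n) :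
    ∃ j < n, f j ≤ y ∧ y < f (j + 1) := by
  induction n with
  | zero => omega
  | succ n ih =>
    by_cases h : y < f n
    · obtain ⟨j, hj, hj'⟩ := ih h
      exact ⟨j, by omega, hj'⟩
    · exact ⟨n, by omega, by omega, hn⟩

/-- The `k` inner knives meet at most `k` of the `k + 1` bundles of a connected allocation, so
some bundle lies entirely between two consecutive knives. -/
theorem IsConnAlloc.exists_subset_between {k m : ℕ} {P : Fin (k + 1) → Finset (Fin m)}
    (hP : IsConnAlloc P) {f : ℕ → ℤ} (h0 : f 0 = 0) (hk : f (k + 1) = 2 * m) :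
    ∃ p, ∃ j : Fin (k + 1), P p ⊆ between m (f j) (f (j + 1)) := by
  obtain ⟨p, hp⟩ : ∃ p, ∀ j : Fin k, ∀ a ∈ P p, ∀ b ∈ P p,
      ¬ (2 * (a : ℤ) < f (j + 1) ∧ f (j + 1) < 2 * (b : ℤ) + 2) := by
    by_contra! hc
    choose g a ha b hb hab using hc
    have hmem : ∀ p, ∃ q : Fin m, (q : ℤ) = f (g p + 1) / 2 ∧ q ∈ P p := by
      intro p
      have h1 := hab p
      have hb' := (b p).is_lt
      refine ⟨⟨(f (g p + 1) / 2).toNat, by omega⟩, ?_, ?_⟩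
      · simp only; omega
      · refine hP.1 p (a p) _ (b p) ?_ ?_ (ha p) (hb p) <;> rw [Fin.le_def] <;> simp only <;> omega
    have hinj : Function.Injective g := by
      intro p p' hpp
      by_contra hne
      obtain ⟨q, hq, hqP⟩ := hmem p
      obtain ⟨q', hq', hqP'⟩ := hmem p'
      have : q = q' := by
        rw [hpp, ← hq'] at hq
        exact Fin.ext (by exact_mod_cast hq)
      subst this
      exact Finset.disjoint_left.mp (hP.2.1 p p' hne) hqP hqP'
    have := Fintype.card_le_of_injective g hinj
    simp at this
  refine ⟨p, ?_⟩
  rcases (P p).eq_empty_or_nonempty with he | hne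
  · exact ⟨0, by simp [he]⟩
  · have hamem := (P p).min'_mem hne
    set a := (P p).min' hne
    have hlt := a.is_lt
    obtain ⟨j, hjk, hj1, hj2⟩ := exists_le_lt_succ (f := f) (y := 2 * (a : ℤ)) (n := k + 1)
      (by omega) (by omega)
    refine ⟨⟨j, hjk⟩, fun b hb => ?_⟩
    have hab : a ≤ b := (P p).min'_le b hb
    rw [Fin.le_def] at hab
    have hblt := b.is_lt
    rw [mem_between]
    refine ⟨by simp only; omega, ?_⟩
    by_contra hcon
    by_cases hjk' : j = k
    · subst hjk'
      simp only [hk] at hcon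
      omega
    · exact hp ⟨j, by omega⟩ a hamem b hb ⟨hj2, by simpa using hcon⟩

theorem MMS_le {n m : ℕ} {u : Finset (Fin m) → ℝ} {x : ℝ} (hx : 0 ≤ x)
    (h : ∀ P : Fin n → Finset (Fin m), IsConnAlloc P → ∃ p, u (P p) ≤ x) : MMS n u ≤ x := by
  refine Real.sSup_le ?_ hx
  rintro y ⟨P, hP, rfl⟩
  obtain ⟨p, hp⟩ := h P hP
  exact (csInf_le (Set.finite_range _).bddBelow ⟨p, rfl⟩).trans hp

/-- An agent with a monotonic valuation has a best piece of positive length. -/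
theorem exists_best_piece {k m : ℕ} (hm : 0 < m) {u : Finset (Fin m) → ℝ} (hu : Monotonic u)
    (l : Fin (k + 1) → ℤ) :
    ∃ b : Fin (k + 1), (0 ≤ l → ∑ j, l j = 2 * m → 0 < l b) ∧
      ∀ j : Fin (k + 1), u (between m (knife l j) (knife l (j + 1))) ≤
        u (between m (knife l b) (knife l (b + 1))) := by
  obtain ⟨b, hb⟩ := Finite.exists_max
    fun j : Fin (k + 1) => u (between m (knife l j) (knife l (j + 1)))
  by_cases h : 0 ≤ l ∧ ∑ j, l j = 2 * m ∧ l b ≤ 0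
  · obtain ⟨h0, hs, hlb⟩ := h
    obtain ⟨c, -, hc⟩ := Finset.exists_lt_of_sum_lt (s := Finset.univ) (f := fun _ => (0 : ℤ))
      (g := l) (by simp only [Finset.sum_const_zero]; omega)
    have he : between m (knife l b) (knife l (b + 1)) = ∅ := by
      ext i
      simp only [mem_between, knife_succ, Finset.notMem_empty, iff_false]
      omega
    refine ⟨c, fun _ _ => hc, fun j => (hb j).trans ?_⟩
    rw [he]
    exact hu _ _ (Finset.empty_subset _)
  · push Not at h
    exact ⟨b, h, hb⟩

/-- A fully labelled cell of the simplex of knife positions, read as a family of nearly equal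
divisions: one division `g i` for each agent `i`, in which `i` finds the piece `b i` best. -/
theorem exists_envy_free_cell {k m : ℕ} (hm : 0 < m) (u : Fin (k + 1) → Finset (Fin m) → ℝ)
    (hmono : ∀ i, Monotonic (u i)) :
    ∃ (f : ℕ → ℤ) (g : Fin (k + 1) → ℕ → ℤ) (b : Fin (k + 1) → Fin (k + 1)),
      f 0 = 0 ∧ f (k + 1) = 2 * m ∧ Monotone f ∧ Function.Injective b ∧
      (∀ i, g i 0 = 0 ∧ g i (k + 1) = 2 * m) ∧
      (∀ i, ∀ j ≤ k + 1, f j ≤ g i j ∧ g i j ≤ f j + 1) ∧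
      ∀ i j : Fin (k + 1), u i (between m (g i j) (g i (j + 1))) ≤
        u i (between m (g i (b i)) (g i (b i + 1))) := by
  choose B hB hbest using fun l : Fin (k + 1) → ℤ =>
    exists_best_piece hm (hmono ((ZMod.finEquiv (k + 1)).symm (owner l))) l
  have hSp : IsSperner (2 * m) B := hB
  have hodd := hSp.odd_ncard_fullCells (by positivity)
  obtain ⟨⟨v, σ⟩, hcell, hinj, hlast⟩ := Set.nonempty_of_ncard_ne_zero hodd.pos.ne'
  simp only at hcell hinj hlast
  have howner : Function.Bijective fun t => (ZMod.finEquiv (k + 1)).symm (owner (v t)) :=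
    Finite.injective_iff_bijective.mp
      ((ZMod.finEquiv (k + 1)).symm.injective.comp hcell.owner_injective)
  choose τ hτ using howner.surjective
  have hτinj : Function.Injective τ := fun i i' h => by rw [← hτ i, ← hτ i', h]
  refine ⟨knife (v 0), fun i => knife (v (τ i)), fun i => B (v (τ i)), knife_zero _, ?_,
    knife_monotone (hcell.nonneg 0), hinj.comp hτinj, fun i => ⟨knife_zero _, ?_⟩,
    fun i j hj => hcell.knife_bounds hlast (τ i) hj, fun i j => ?_⟩
  · rw [knife_add_one_eq_sum, hcell.sum_eq]
  · exact (knife_add_one_eq_sum _).trans (hcell.sum_eq _)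
  · have := hbest (v (τ i)) j
    have h := hτ i
    simp only at h
    rwa [h] at this

/-- The rounded division is obtained by moving every knife to the even position of its range. -/
theorem isConnAlloc_rounded {k m : ℕ} {f : ℕ → ℤ} (h0 : f 0 = 0) (hk : f (k + 1) = 2 * m)
    (hf : Monotone f) {b : Fin (k + 1) → Fin (k + 1)} (hb : Function.Injective b) :
    IsConnAlloc fun i =>
      between m (2 * ((f (b i) + 1) / 2)) (2 * ((f (b i + 1) + 1) / 2)) := by
  refine ⟨fun i => isInterval_between _ _ _, ?_, ?_⟩
  · have key : ∀ i j, b i < b j → Disjoint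
        (between m (2 * ((f (b i) + 1) / 2)) (2 * ((f (b i + 1) + 1) / 2)))
        (between m (2 * ((f (b j) + 1) / 2)) (2 * ((f (b j + 1) + 1) / 2))) := by
      intro i j hij
      rw [Finset.disjoint_left]
      intro x hx hx'
      rw [mem_between] at hx hx'
      have : f (b i + 1) ≤ f (b j) := hf (Fin.lt_def.mp hij)
      omega
    intro i j hij
    rcases lt_or_gt_of_ne (hb.ne hij) with h | h
    · exact key i j h
    · exact (key j i h).symm
  · intro x
    have hx := x.is_lt
    obtain ⟨j, hj, h1, h2⟩ := exists_le_lt_succ (f := fun j => 2 * ((f j + 1) / 2))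
      (y := 2 * (x : ℤ)) (n := k + 1) (by omega) (by omega)
    obtain ⟨i, hi⟩ := Finite.surjective_of_injective hb ⟨j, hj⟩
    refine ⟨i, ?_⟩
    simp only [hi, mem_between]
    omega

/-- Removing both end items of a rounded piece leaves only items of the original piece. -/
theorem exists_outer_items {m : ℕ} {a b a' b' : ℤ} (ha : a' ≤ a + 2) (hb : b ≤ b' + 2)
    (hcard : ¬ (between m a b).card ≤ 1) :
    ∃ v ∈ between m a b, ∃ w ∈ between m a b, v ≠ w ∧
      IsInterval (between m a b \ {v, w}) ∧ between m a b \ {v, w} ⊆ between m a' b' := by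
  have hne : (between m a b).Nonempty := by
    rw [← Finset.card_pos]; omega
  have hlt := Finset.min'_lt_max'_of_card _ (not_le.mp hcard)
  have hmin := Finset.min'_mem _ hne
  have hmax := Finset.max'_mem _ hne
  set v := (between m a b).min' hne
  set w := (between m a b).max' hne
  have hmem : ∀ x, x ∈ between m a b \ {v, w} ↔ x ∈ between m a b ∧ v < x ∧ x < w := by
    intro x
    simp only [Finset.mem_sdiff, Finset.mem_insert, Finset.mem_singleton, not_or,
      and_congr_right_iff]
    intro hx
    have h1 : v ≤ x := Finset.min'_le _ _ hx
    have h2 : x ≤ w := Finset.le_max' _ _ hx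
    exact ⟨fun h => ⟨lt_of_le_of_ne h1 (Ne.symm h.1), lt_of_le_of_ne h2 h.2⟩,
      fun h => ⟨h.1.ne', h.2.ne⟩⟩
  refine ⟨v, hmin, w, hmax, hlt.ne, ?_, ?_⟩
  · intro x y z hxy hyz hx hz
    rw [hmem] at *
    exact ⟨isInterval_between m a b x y z hxy hyz hx.1 hz.1, hx.2.1.trans_le hxy,
      hyz.trans_lt hz.2.2⟩
  · intro x hx
    rw [hmem] at hx
    obtain ⟨-, h1, h2⟩ := hx
    rw [Fin.lt_def] at h1 h2
    rw [mem_between] at *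
    omega

/-- on a path of `m` items, for any number `n ≥ 1` of agents with monotonic
valuations, there is a connected allocation that is simultaneously EF2 and MMS. -/
theorem EF2_and_MMS_exists {n m : ℕ} (hn : 0 < n)
    (u : Fin n → Finset (Fin m) → ℝ)
    (hmono : ∀ i, Monotonic (u i)) (h0 : ∀ i, u i ∅ = 0) :
    ∃ A : Fin n → Finset (Fin m), IsConnAlloc A ∧ EF2 u A ∧
      ∀ i : Fin n, MMS n (u i) ≤ u i (A i) := by
  have hnonneg : ∀ i X, 0 ≤ u i X := fun i X => h0 i ▸ hmono i ∅ X (Finset.empty_subset X)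
  rcases Nat.eq_zero_or_pos m with rfl | hm
  · refine ⟨fun _ => ∅, ⟨fun _ a => a.elim0, fun _ _ _ => Finset.disjoint_empty_left _,
      fun a => a.elim0⟩, fun _ _ => Or.inl (by simp), fun i => ?_⟩
    refine MMS_le (hnonneg i _) fun P _ => ⟨i, ?_⟩
    rw [Finset.eq_empty_of_isEmpty (P i)]
  obtain ⟨k, rfl⟩ : ∃ k, n = k + 1 := ⟨n - 1, by omega⟩
  obtain ⟨f, g, b, hf0, hfk, hf, hb, hg, hfg, hbest⟩ := exists_envy_free_cell hm u hmono
  have hA := isConnAlloc_rounded hf0 hfk hf hb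
  have hown : ∀ i, u i (between m (g i (b i)) (g i (b i + 1))) ≤
      u i (between m (2 * ((f (b i) + 1) / 2)) (2 * ((f (b i + 1) + 1) / 2))) := by
    intro i
    refine hmono i _ _ fun x hx => ?_
    have h1 := hfg i (b i) (by omega)
    have h2 := hfg i (b i + 1) (by omega)
    rw [mem_between] at *
    omega
  refine ⟨_, hA, fun i j => ?_, fun i => MMS_le (hnonneg i _) fun P hP => ?_⟩
  · rw [or_iff_not_imp_left]
    intro hcard
    have h1 := hfg i (b j) (by omega)
    have h2 := hfg i (b j + 1) (by omega)
    obtain ⟨v, hv, w, hw, hvw, hint, hsub⟩ := exists_outer_items (a' := g i (b j))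
      (b' := g i (b j + 1)) (by omega) (by omega) hcard
    exact ⟨v, hv, w, hw, hvw, hint,
      ((hmono i _ _ hsub).trans (hbest i (b j))).trans (hown i)⟩
  · obtain ⟨p, j, hpj⟩ := hP.exists_subset_between (hg i).1 (hg i).2
    exact ⟨p, ((hmono i _ _ hpj).trans (hbest i j)).trans (hown i)⟩
end

section
/- On a path of m items, for two agents with monotonic valuations, there exists a connected allocation that is simultaneously EF1 and MMS (each agent i receives a bundle of value u_i at least MMS_i). -/
/-- The items of the path strictly before position `k`. -/
def leftPart (m k : ℕ) : Finset (Fin m) := Finset.univ.filter fun v => v.val < k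

/-- The items of the path from position `k` on. -/
def rightPart (m k : ℕ) : Finset (Fin m) := Finset.univ.filter fun v => k ≤ v.val

theorem mem_leftPart {m k : ℕ} {v : Fin m} : v ∈ leftPart m k ↔ v.val < k := by
  simp [leftPart]

theorem mem_rightPart {m k : ℕ} {v : Fin m} : v ∈ rightPart m k ↔ k ≤ v.val := by
  simp [rightPart]

theorem isInterval_leftPart (m k : ℕ) : IsInterval (leftPart m k) := by
  intro a b c _ hbc _ hc
  rw [mem_leftPart] at *
  exact lt_of_le_of_lt hbc hc

theorem isInterval_rightPart (m k : ℕ) : IsInterval (rightPart m k) := by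
  intro a b c hab _ ha _
  rw [mem_rightPart] at *
  exact le_trans ha hab

theorem leftPart_mono {m j k : ℕ} (h : j ≤ k) : leftPart m j ⊆ leftPart m k := by
  intro v hv
  rw [mem_leftPart] at *
  omega

theorem rightPart_anti {m j k : ℕ} (h : j ≤ k) : rightPart m k ⊆ rightPart m j := by
  intro v hv
  rw [mem_rightPart] at *
  omega

theorem disjoint_leftPart_rightPart (m k : ℕ) : Disjoint (leftPart m k) (rightPart m k) := by
  rw [Finset.disjoint_left]
  intro v hv
  rw [mem_leftPart] at hv
  rw [mem_rightPart]
  omega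

theorem leftPart_eq_empty_or_sdiff (m k : ℕ) (hk : k ≤ m) :
    leftPart m k = ∅ ∨ ∃ v ∈ leftPart m k, leftPart m k \ {v} = leftPart m (k - 1) := by
  rcases Nat.eq_zero_or_pos k with rfl | hpos
  · left
    ext v
    simp [mem_leftPart]
  · right
    refine ⟨⟨k - 1, by omega⟩, mem_leftPart.2 (by simp; omega), ?_⟩
    ext v
    simp only [Finset.mem_sdiff, mem_leftPart, Finset.mem_singleton, Fin.ext_iff]
    omega

theorem rightPart_eq_empty_or_sdiff (m k : ℕ) :
    rightPart m k = ∅ ∨ ∃ v ∈ rightPart m k, rightPart m k \ {v} = rightPart m (k + 1) := by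
  rcases Nat.lt_or_ge k m with hk | hk
  · right
    refine ⟨⟨k, hk⟩, mem_rightPart.2 le_rfl, ?_⟩
    ext v
    simp only [Finset.mem_sdiff, mem_rightPart, Finset.mem_singleton, Fin.ext_iff]
    omega
  · left
    ext v
    simp only [mem_rightPart, Finset.notMem_empty, iff_false]
    omega

theorem exists_cut_of_lt {m : ℕ} {I J : Finset (Fin m)} (hI : IsInterval I) (hJ : IsInterval J)
    (hd : Disjoint I J) {x y : Fin m} (hx : x ∈ I) (hy : y ∈ J) (hxy : x < y) :
    ∃ k, I ⊆ leftPart m k ∧ J ⊆ rightPart m k := by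
  have hd' := Finset.disjoint_left.1 hd
  have hmin := J.min'_mem ⟨y, hy⟩
  refine ⟨(J.min' ⟨y, hy⟩).val, fun z hz => ?_, fun z hz => ?_⟩
  · rw [mem_leftPart]
    by_contra! hle
    refine hd' (hI x _ z ?_ hle hx hz) hmin
    by_contra! hlt
    exact hd' hx (hJ _ x y hlt.le hxy.le hmin hy)
  · rw [mem_rightPart]
    exact J.min'_le z hz

theorem exists_cut {m : ℕ} {I J : Finset (Fin m)} (hI : IsInterval I) (hJ : IsInterval J)
    (hd : Disjoint I J) :
    ∃ k, (I ⊆ leftPart m k ∧ J ⊆ rightPart m k) ∨ (J ⊆ leftPart m k ∧ I ⊆ rightPart m k) := by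
  rcases I.eq_empty_or_nonempty with rfl | ⟨x, hx⟩
  · exact ⟨0, .inl ⟨Finset.empty_subset _, fun v _ => mem_rightPart.2 (Nat.zero_le _)⟩⟩
  rcases J.eq_empty_or_nonempty with rfl | ⟨y, hy⟩
  · exact ⟨0, .inr ⟨Finset.empty_subset _, fun v _ => mem_rightPart.2 (Nat.zero_le _)⟩⟩
  rcases lt_trichotomy x y with h | rfl | h
  · obtain ⟨k, hk⟩ := exists_cut_of_lt hI hJ hd hx hy h
    exact ⟨k, .inl hk⟩
  · exact absurd hy (Finset.disjoint_left.1 hd hx)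
  · obtain ⟨k, hk⟩ := exists_cut_of_lt hJ hI hd.symm hy hx h
    exact ⟨k, .inr hk⟩

theorem MMS_two_le {m : ℕ} {u : Finset (Fin m) → ℝ} (hu : Monotonic u) {c : ℝ} (hc : 0 ≤ c)
    (h : ∀ k, u (leftPart m k) ≤ c ∨ u (rightPart m k) ≤ c) : MMS 2 u ≤ c := by
  refine Real.sSup_le ?_ hc
  rintro _ ⟨P, ⟨hint, hdis, -⟩, rfl⟩
  have hle (j : Fin 2) : sInf (Set.range fun j => u (P j)) ≤ u (P j) :=
    csInf_le (Set.finite_range _).bddBelow ⟨j, rfl⟩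
  obtain ⟨k, ⟨h1, h2⟩ | ⟨h1, h2⟩⟩ := exists_cut (hint 0) (hint 1) (hdis 0 1 (by decide)) <;>
    rcases h k with h3 | h3 <;>
    linarith [hle 0, hle 1, hu _ _ h1, hu _ _ h2]

/-- Some cut makes both parts acceptable to a given agent, up to one outer good and with
respect to her maximin share. -/
theorem exists_balanced_cut {m : ℕ} {u : Finset (Fin m) → ℝ} (hu : Monotonic u) (h0 : u ∅ = 0) :
    ∃ k ≤ m, u (rightPart m (k + 1)) ≤ u (leftPart m k) ∧
      u (leftPart m (k - 1)) ≤ u (rightPart m k) ∧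
      MMS 2 u ≤ u (leftPart m k) ∧ MMS 2 u ≤ u (rightPart m k) := by
  classical
  have hnn (X : Finset (Fin m)) : 0 ≤ u X := h0 ▸ hu _ _ (Finset.empty_subset X)
  have hm : u (rightPart m (m + 1)) ≤ u (leftPart m m) := by
    have he : rightPart m (m + 1) = ∅ := by
      ext v
      simp only [mem_rightPart, Finset.notMem_empty, iff_false]
      omega
    rw [he, h0]
    exact hnn _
  have hex : ∃ k, u (rightPart m (k + 1)) ≤ u (leftPart m k) := ⟨m, hm⟩
  obtain ⟨k, hkm, hk, hlt⟩ : ∃ k ≤ m, u (rightPart m (k + 1)) ≤ u (leftPart m k) ∧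
      ∀ j < k, u (leftPart m j) ≤ u (rightPart m (j + 1)) :=
    ⟨Nat.find hex, Nat.find_min' hex hm, Nat.find_spec hex,
      fun j hj => (not_le.1 (Nat.find_min hex hj)).le⟩
  have hlow (j : ℕ) (hj : j < k) : u (leftPart m j) ≤ u (rightPart m k) := by
    have h1 := hlt (k - 1) (by omega)
    rw [Nat.sub_add_cancel (by omega)] at h1
    exact (hu _ _ (leftPart_mono (by omega))).trans h1
  refine ⟨k, hkm, hk, ?_, MMS_two_le hu (hnn _) fun j => ?_, MMS_two_le hu (hnn _) fun j => ?_⟩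
  · rcases Nat.eq_zero_or_pos k with rfl | hpos
    · refine hu _ _ fun v hv => ?_
      exact mem_rightPart.2 (Nat.zero_le _)
    · exact hlow _ (by omega)
  · rcases Nat.lt_or_ge k j with hj | hj
    · exact .inr ((hu _ _ (rightPart_anti hj)).trans hk)
    · exact .inl (hu _ _ (leftPart_mono hj))
  · rcases Nat.lt_or_ge j k with hj | hj
    · exact .inl (hlow j hj)
    · exact .inr (hu _ _ (rightPart_anti hj))

theorem MMS_two_le_max {m : ℕ} {u : Finset (Fin m) → ℝ} (hu : Monotonic u) (h0 : u ∅ = 0)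
    (k : ℕ) : MMS 2 u ≤ max (u (leftPart m k)) (u (rightPart m k)) := by
  refine MMS_two_le hu (le_max_of_le_left (h0 ▸ hu _ _ (Finset.empty_subset _))) fun j => ?_
  rcases le_total j k with h | h
  · exact .inl (le_max_of_le_left (hu _ _ (leftPart_mono h)))
  · exact .inr (le_max_of_le_right (hu _ _ (rightPart_anti h)))

theorem isConnAlloc_two {m : ℕ} {I J : Finset (Fin m)} (hI : IsInterval I) (hJ : IsInterval J)
    (hd : Disjoint I J) (hc : ∀ v, v ∈ I ∨ v ∈ J) : IsConnAlloc ![I, J] := by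
  refine ⟨Fin.forall_fin_two.2 ⟨hI, hJ⟩, ?_, fun v => Fin.exists_fin_two.2 (hc v)⟩
  simp [Fin.forall_fin_two, hd, hd.symm]

theorem EF1_two {m : ℕ} {u : Fin 2 → Finset (Fin m) → ℝ} (hmono : ∀ i, Monotonic (u i))
    {I J I' J' : Finset (Fin m)} (hI' : IsInterval I') (hJ' : IsInterval J')
    (hI : I = ∅ ∨ ∃ v ∈ I, I \ {v} = I') (hJ : J = ∅ ∨ ∃ v ∈ J, J \ {v} = J')
    (h₀ : u 0 J' ≤ u 0 I) (h₁ : u 1 I' ≤ u 1 J) : EF1 u ![I, J] := by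
  have key (i : Fin 2) (X Y Y' : Finset (Fin m)) (hY' : IsInterval Y')
      (hY : Y = ∅ ∨ ∃ v ∈ Y, Y \ {v} = Y') (h : u i Y' ≤ u i X) :
      Y = ∅ ∨ ∃ v ∈ Y, IsInterval (Y \ {v}) ∧ u i (Y \ {v}) ≤ u i X := by
    rcases hY with hY | ⟨v, hv, rfl⟩
    · exact .inl hY
    · exact .inr ⟨v, hv, hY', h⟩
  have self (i : Fin 2) (Y Y' : Finset (Fin m)) (hY' : IsInterval Y')
      (hY : Y = ∅ ∨ ∃ v ∈ Y, Y \ {v} = Y') :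
      Y = ∅ ∨ ∃ v ∈ Y, IsInterval (Y \ {v}) ∧ u i (Y \ {v}) ≤ u i Y := by
    rcases hY with hY | ⟨v, hv, rfl⟩
    · exact .inl hY
    · exact .inr ⟨v, hv, hY', hmono i _ _ Finset.sdiff_subset⟩
  exact Fin.forall_fin_two.2 ⟨Fin.forall_fin_two.2 ⟨self 0 I I' hI' hI, key 0 I J J' hJ' hJ h₀⟩,
    Fin.forall_fin_two.2 ⟨key 1 J I I' hI' hI h₁, self 1 J J' hJ' hJ⟩⟩

/-- on a path of `m` items, for two agents with monotonic valuations,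
there is a connected allocation that is simultaneously EF1 and MMS. -/
theorem EF1_and_MMS_two_agents {m : ℕ}
    (u : Fin 2 → Finset (Fin m) → ℝ)
    (hmono : ∀ i, Monotonic (u i)) (h0 : ∀ i, u i ∅ = 0) :
    ∃ A : Fin 2 → Finset (Fin m), IsConnAlloc A ∧ EF1 u A ∧
      ∀ i : Fin 2, MMS 2 (u i) ≤ u i (A i) := by
  obtain ⟨k, hkm, hl, hr, hml, hmr⟩ := exists_balanced_cut (hmono 0) (h0 0)
  have hmax := MMS_two_le_max (hmono 1) (h0 1) k
  have hL := isInterval_leftPart m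
  have hR := isInterval_rightPart m
  have hd := disjoint_leftPart_rightPart m k
  have hLe := leftPart_eq_empty_or_sdiff m k hkm
  have hRe := rightPart_eq_empty_or_sdiff m k
  have hcov (v : Fin m) : v ∈ leftPart m k ∨ v ∈ rightPart m k := by
    rw [mem_leftPart, mem_rightPart]
    exact lt_or_ge _ _
  rcases le_total (u 1 (leftPart m k)) (u 1 (rightPart m k)) with h | h
  · rw [max_eq_right h] at hmax
    exact ⟨![leftPart m k, rightPart m k], isConnAlloc_two (hL k) (hR k) hd hcov,
      EF1_two hmono (hL _) (hR _) hLe hRe hl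
        ((hmono 1 _ _ (leftPart_mono (Nat.sub_le k 1))).trans h),
      Fin.forall_fin_two.2 ⟨hml, hmax⟩⟩
  · rw [max_eq_left h] at hmax
    exact ⟨![rightPart m k, leftPart m k],
      isConnAlloc_two (hR k) (hL k) hd.symm fun v => (hcov v).symm,
      EF1_two hmono (hR _) (hL _) hRe hLe hr
        ((hmono 1 _ _ (rightPart_anti (Nat.le_succ k))).trans h),
      Fin.forall_fin_two.2 ⟨hmr, hmax⟩⟩
end

section
/- Connected EFX allocations need not exist on a path: for three agents with identical additive valuations on a path of four items with singleton values 2, 3, 1, 3 (in path order), no connected allocation satisfies EFX. -/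
/-- EFX (envy-freeness up to any outer good) on a path: removing any single item whose
removal leaves the envied bundle connected must eliminate envy. -/
def EFX {n m : ℕ} (u : Fin n → Finset (Fin m) → ℝ) (A : Fin n → Finset (Fin m)) : Prop :=
  ∀ i j : Fin n, ∀ v ∈ A j, IsInterval (A j \ {v}) → u i (A j \ {v}) ≤ u i (A i)

instance {m : ℕ} (I : Finset (Fin m)) : Decidable (IsInterval I) :=
  inferInstanceAs (Decidable (∀ a b c : Fin m, a ≤ b → b ≤ c → a ∈ I → c ∈ I → b ∈ I))

/-- The singleton values `2, 3, 1, 3`, as natural numbers. -/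
def pathWeight : Fin 4 → ℕ := ![2, 3, 1, 3]

/-- The bundle of agent `i` when item `v` is owned by agent `f v`. -/
def ownedBundle (f : Fin 4 → Fin 3) (i : Fin 3) : Finset (Fin 4) :=
  Finset.univ.filter fun v => f v = i

lemma exists_envy_of_owner : ∀ f : Fin 4 → Fin 3, (∀ i, IsInterval (ownedBundle f i)) →
    ∃ i j v, v ∈ ownedBundle f j ∧ IsInterval (ownedBundle f j \ {v}) ∧
      ∑ x ∈ ownedBundle f i, pathWeight x < ∑ x ∈ ownedBundle f j \ {v}, pathWeight x := by
  decide +kernel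

lemma sum_path_eq_cast_pathWeight (I : Finset (Fin 4)) :
    ∑ v ∈ I, (![2, 3, 1, 3] : Fin 4 → ℝ) v = ((∑ v ∈ I, pathWeight v : ℕ) : ℝ) := by
  push_cast
  refine Finset.sum_congr rfl fun v _ => ?_
  fin_cases v <;> simp [pathWeight]

lemma IsConnAlloc.exists_eq_ownedBundle {A : Fin 3 → Finset (Fin 4)} (hA : IsConnAlloc A) :
    ∃ f, A = ownedBundle f := by
  obtain ⟨-, hdisj, hcover⟩ := hA
  choose f hf using hcover
  refine ⟨f, funext fun i => Finset.ext fun v => ?_⟩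
  simp only [ownedBundle, Finset.mem_filter, Finset.mem_univ, true_and]
  refine ⟨fun hv => ?_, fun h => h ▸ hf v⟩
  by_contra hne
  exact Finset.disjoint_left.mp (hdisj _ _ hne) (hf v) hv

/-- connected EFX allocations need not exist on a path: for three agents
with identical additive valuations on the path of four items with singleton values
`2, 3, 1, 3` (in path order), no connected allocation is EFX. -/
theorem no_EFX_on_path (u : Finset (Fin 4) → ℝ)
    (hu : ∀ I : Finset (Fin 4), u I = ∑ v ∈ I, (![2, 3, 1, 3] : Fin 4 → ℝ) v) :
    ∀ A : Fin 3 → Finset (Fin 4), IsConnAlloc A → ¬ EFX (fun _ => u) A := by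
  intro A hA hEFX
  obtain ⟨f, rfl⟩ := hA.exists_eq_ownedBundle
  obtain ⟨i, j, v, hv, hint, hlt⟩ := exists_envy_of_owner f hA.1
  have hle := hEFX i j v hv hint
  simp only [hu, sum_path_eq_cast_pathWeight, Nat.cast_le] at hle
  exact absurd hle (not_le.mpr hlt)
end
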